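/- Let R₂ = 32π⁴/(3(1+√2)⁴). Let u be an admissible solution of the vorticity equation on [0,T) with viscosity ν > 0, with ω = ∇×u and ω_h = (ω₁, ω₂, 0). Then for every t ∈ [0,T), ‖ω_h(t,·)‖²_{Ḣ^{−1/2}} ≤ ‖ω_h(0,·)‖²_{Ḣ^{−1/2}} · exp( (1/(R₂ ν³)) ∫₀ᵗ ‖ω(τ,·)‖⁴_{L²(ℝ³)} dτ ). -/

import Mathlib

open MeasureTheory Real SchwartzMap
open scoped FourierTransform ENNReal

noncomputable section

/-- Euclidean three-space. -/
abbrev E3 : Type := EuclideanSpace ℝ (Fin 3)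

/-- The `i`-th standard basis vector. -/
def ee (i : Fin 3) : E3 := EuclideanSpace.single i 1

/-- The partial derivative `∂ᵢ f`. -/
def pd (i : Fin 3) (f : E3 → ℝ) : E3 → ℝ := fun x => fderiv ℝ f x (ee i)

/-- The Fourier transform (kernel `e^{-2πi x·ξ}`) of a real-valued function. -/
def ft (f : E3 → ℝ) : E3 → ℂ := 𝓕 (fun x => (f x : ℂ))

/-- The squared homogeneous Sobolev norm `‖v‖²_{Ḣ^s}` of a vector field. -/
def hsV (s : ℝ) (v : Fin 3 → E3 → ℝ) : ℝ :=
  ∫ ξ : E3, (2 * π * ‖ξ‖) ^ (2 * s) * ∑ i, ‖ft (v i) ξ‖ ^ 2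

/-- The curl `ω = ∇ × u` of a vector field. -/
def curl (u : Fin 3 → E3 → ℝ) : Fin 3 → E3 → ℝ :=
  ![fun x => pd 1 (u 2) x - pd 2 (u 1) x,
    fun x => pd 2 (u 0) x - pd 0 (u 2) x,
    fun x => pd 0 (u 1) x - pd 1 (u 0) x]

/-- The strain tensor `S = (∇u + (∇u)ᵀ)/2`. -/
def strain (u : Fin 3 → E3 → ℝ) : Fin 3 → Fin 3 → E3 → ℝ :=
  fun i j x => (pd i (u j) x + pd j (u i) x) / 2

/-- The time interval `[0,T)` for `T ∈ (0,∞]`. -/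
def timeSet (T : ℝ≥0∞) : Set ℝ := {t : ℝ | 0 ≤ t ∧ ENNReal.ofReal t < T}

/-- An admissible solution of the vorticity equation on `[0,T)` with viscosity `ν`:
`u` is jointly smooth, Schwartz in space at each time with time-locally uniform
Schwartz seminorm bounds (also for `∂ₜu`), divergence free, and its vorticity
`ω = ∇×u` satisfies `∂ₜω − νΔω + (u·∇)ω − Sω = 0` on `[0,T) × ℝ³`. -/
structure AdmissibleSolution (ν : ℝ) (T : ℝ≥0∞) where
  u : ℝ → Fin 3 → 𝓢(E3, ℝ)
  u' : ℝ → Fin 3 → 𝓢(E3, ℝ)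
  smooth : ∀ i : Fin 3,
    ContDiffOn ℝ (⊤ : ℕ∞) (fun p : ℝ × E3 => u p.1 i p.2) (timeSet T ×ˢ Set.univ)
  tderiv : ∀ t ∈ timeSet T, ∀ i : Fin 3, ∀ x : E3,
    HasDerivWithinAt (fun s => u s i x) (u' t i x) (timeSet T) t
  seminorm_bdd : ∀ K : Set ℝ, IsCompact K → K ⊆ timeSet T → ∀ k n : ℕ, ∀ i : Fin 3,
    ∃ C : ℝ, ∀ t ∈ K, SchwartzMap.seminorm ℝ k n (u t i) ≤ C ∧
      SchwartzMap.seminorm ℝ k n (u' t i) ≤ C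
  divfree : ∀ t ∈ timeSet T, ∀ x : E3, ∑ i, pd i (⇑(u t i)) x = 0
  vort_eq : ∀ t ∈ timeSet T, ∀ x : E3, ∀ k : Fin 3,
    derivWithin (fun s => curl (fun i => ⇑(u s i)) k x) (timeSet T) t
      - ν * (∑ i, pd i (pd i (curl (fun i => ⇑(u t i)) k)) x)
      + (∑ i, u t i x * pd i (curl (fun i => ⇑(u t i)) k) x)
      - (∑ j, strain (fun i => ⇑(u t i)) k j x * curl (fun i => ⇑(u t i)) j x) = 0

/-- The vorticity of an admissible solution at time `t`. -/
def AdmissibleSolution.vort {ν : ℝ} {T : ℝ≥0∞} (sol : AdmissibleSolution ν T)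
    (t : ℝ) : Fin 3 → E3 → ℝ :=
  curl (fun i => ⇑(sol.u t i))

/-- The horizontal part `ω_h = (ω₁, ω₂, 0)` of the vorticity. -/
def AdmissibleSolution.vorth {ν : ℝ} {T : ℝ≥0∞} (sol : AdmissibleSolution ν T)
    (t : ℝ) : Fin 3 → E3 → ℝ :=
  ![sol.vort t 0, sol.vort t 1, fun _ => 0]

/-- The enstrophy `E(t) = (1/2)‖ω(t,·)‖²_{L²}`. -/
def AdmissibleSolution.enstrophy {ν : ℝ} {T : ℝ≥0∞} (sol : AdmissibleSolution ν T)
    (t : ℝ) : ℝ :=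
  (1 / 2) * ∫ x : E3, ∑ k, (sol.vort t k x) ^ 2

/-- The constant `R₂ = 32π⁴/(3(1+√2)⁴)`. -/
def R₂ : ℝ := 32 * π ^ 4 / (3 * (1 + Real.sqrt 2) ^ 4)

/-- Euclidean length of a complex 3-vector. -/
def n3 (z : Fin 3 → ℂ) : ℝ := √(‖z 0‖ ^ 2 + ‖z 1‖ ^ 2 + ‖z 2‖ ^ 2)

/-- Symbol of the curl. -/
def cr (ξ : E3) (v : Fin 3 → ℂ) : Fin 3 → ℂ :=
  ![2 * π * Complex.I * (ξ 1 * v 2 - ξ 2 * v 1),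
    2 * π * Complex.I * (ξ 2 * v 0 - ξ 0 * v 2),
    2 * π * Complex.I * (ξ 0 * v 1 - ξ 1 * v 0)]

/-- Length of the horizontal part. -/
def gh (w : Fin 3 → ℂ) : ℝ := √(‖w 0‖ ^ 2 + ‖w 1‖ ^ 2)

/-- Bilinear dot product. -/
def dotc (ξ : E3) (v : Fin 3 → ℂ) : ℂ := ξ 0 * v 0 + ξ 1 * v 1 + ξ 2 * v 2

/-- Symbol of the strain. -/
def sy (ξ : E3) (v : Fin 3 → ℂ) (k j : Fin 3) : ℂ := π * Complex.I * (ξ k * v j + ξ j * v k)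

/-- Integrand of the Fourier transform of the nonlinearity. -/
def nlk (ζ η : E3) (z b : Fin 3 → ℂ) (k : Fin 3) : ℂ :=
  2 * π * Complex.I * dotc η z * cr η b k - (sy ζ z k 0 * cr η b 0 + sy ζ z k 1 * cr η b 1)
    - sy η b k 2 * cr ζ z 2

lemma n3_nonneg (z) : 0 ≤ n3 z := Real.sqrt_nonneg _
lemma gh_nonneg (z) : 0 ≤ gh z := Real.sqrt_nonneg _
lemma n3_sq (z) : n3 z ^ 2 = ‖z 0‖ ^ 2 + ‖z 1‖ ^ 2 + ‖z 2‖ ^ 2 := Real.sq_sqrt (by positivity)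
lemma gh_sq (z) : gh z ^ 2 = ‖z 0‖ ^ 2 + ‖z 1‖ ^ 2 := Real.sq_sqrt (by positivity)

lemma E3_norm_sq (ξ : E3) : ‖ξ‖ ^ 2 = ξ 0 ^ 2 + ξ 1 ^ 2 + ξ 2 ^ 2 := by
  rw [EuclideanSpace.real_norm_sq_eq, Fin.sum_univ_three]

lemma cs3 (z b : Fin 3 → ℂ) : ‖z 0 * b 0 + z 1 * b 1 + z 2 * b 2‖ ≤ n3 z * n3 b := by
  have h1 : ‖z 0 * b 0 + z 1 * b 1 + z 2 * b 2‖ ≤ ‖z 0‖ * ‖b 0‖ + ‖z 1‖ * ‖b 1‖ + ‖z 2‖ * ‖b 2‖ := by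
    refine (norm_add₃_le).trans ?_
    simp [norm_mul]
  refine h1.trans (abs_le_of_sq_le_sq' ?_ (mul_nonneg (n3_nonneg _) (n3_nonneg _))).2
  rw [mul_pow, n3_sq, n3_sq]
  nlinarith [sq_nonneg (‖z 0‖ * ‖b 1‖ - ‖z 1‖ * ‖b 0‖), sq_nonneg (‖z 0‖ * ‖b 2‖ - ‖z 2‖ * ‖b 0‖),
    sq_nonneg (‖z 1‖ * ‖b 2‖ - ‖z 2‖ * ‖b 1‖)]

lemma cs2 (z b : Fin 3 → ℂ) : ‖z 0 * b 0 + z 1 * b 1‖ ≤ gh z * gh b := by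
  have h1 : ‖z 0 * b 0 + z 1 * b 1‖ ≤ ‖z 0‖ * ‖b 0‖ + ‖z 1‖ * ‖b 1‖ := by
    refine (norm_add_le _ _).trans ?_
    simp [norm_mul]
  refine h1.trans (abs_le_of_sq_le_sq' ?_ (mul_nonneg (gh_nonneg _) (gh_nonneg _))).2
  rw [mul_pow, gh_sq, gh_sq]
  nlinarith [sq_nonneg (‖z 0‖ * ‖b 1‖ - ‖z 1‖ * ‖b 0‖)]

lemma cnorm_sq (z : ℂ) : ‖z‖ ^ 2 = z.re ^ 2 + z.im ^ 2 := by
  rw [← Complex.normSq_eq_norm_sq, Complex.normSq_apply]; ring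

lemma dotc_le (ξ : E3) (v) : ‖dotc ξ v‖ ≤ ‖ξ‖ * n3 v := by
  have := cs3 (fun i => (ξ i : ℂ)) v
  have h : n3 (fun i => (ξ i : ℂ)) = ‖ξ‖ := by
    rw [← sq_eq_sq₀ (n3_nonneg _) (norm_nonneg _), n3_sq, E3_norm_sq]
    simp
  rw [h] at this
  exact this

lemma bessel (ζ : E3) (z b : Fin 3 → ℂ) (hz : dotc ζ z = 0) :
    ‖ζ‖ ^ 2 * ‖z 0 * b 0 + z 1 * b 1 + z 2 * b 2‖ ^ 2 + n3 z ^ 2 * ‖dotc ζ b‖ ^ 2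
      ≤ ‖ζ‖ ^ 2 * n3 z ^ 2 * n3 b ^ 2 := by
  rcases eq_or_ne ζ 0 with rfl | hne
  · simp [dotc]
  have hpos : 0 < ‖ζ‖ ^ 2 := by positivity
  set B : Fin 3 → ℂ := fun i => ((‖ζ‖ ^ 2 : ℝ) : ℂ) * b i - dotc ζ b * ζ i with hB
  have h1 : z 0 * B 0 + z 1 * B 1 + z 2 * B 2
      = ((‖ζ‖ ^ 2 : ℝ) : ℂ) * (z 0 * b 0 + z 1 * b 1 + z 2 * b 2) := by
    have : z 0 * B 0 + z 1 * B 1 + z 2 * B 2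
      = ((‖ζ‖ ^ 2 : ℝ) : ℂ) * (z 0 * b 0 + z 1 * b 1 + z 2 * b 2) - dotc ζ b * dotc ζ z := by
      simp only [hB, dotc]; ring
    rw [this, hz]; ring
  have h2 : n3 B ^ 2 = ‖ζ‖ ^ 2 * (‖ζ‖ ^ 2 * n3 b ^ 2 - ‖dotc ζ b‖ ^ 2) := by
    have hR := E3_norm_sq ζ
    simp only [hB]
    generalize ‖ζ‖ ^ 2 = R at hR
    rw [n3_sq, n3_sq]
    simp only [cnorm_sq, dotc, Complex.sub_re, Complex.sub_im, Complex.mul_re, Complex.mul_im,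
      Complex.add_re, Complex.add_im, Complex.ofReal_re, Complex.ofReal_im]
    rw [hR]
    ring
  have h3 := cs3 z B
  rw [h1, norm_mul] at h3
  have h4 : (‖ζ‖ ^ 2 * ‖z 0 * b 0 + z 1 * b 1 + z 2 * b 2‖) ^ 2 ≤ n3 z ^ 2 * n3 B ^ 2 := by
    rw [← mul_pow]
    refine pow_le_pow_left₀ (by positivity) ?_ 2
    simpa using h3
  rw [h2] at h4
  have h5 : ‖ζ‖ ^ 2 * (‖ζ‖ ^ 2 * ‖z 0 * b 0 + z 1 * b 1 + z 2 * b 2‖ ^ 2 + n3 z ^ 2 * ‖dotc ζ b‖ ^ 2)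
      ≤ ‖ζ‖ ^ 2 * (‖ζ‖ ^ 2 * n3 z ^ 2 * n3 b ^ 2) := by nlinarith
  exact le_of_mul_le_mul_left h5 hpos

lemma strain_op (ζ : E3) (z a b : Fin 3 → ℂ) (hz : dotc ζ z = 0) :
    ‖dotc ζ a * (z 0 * b 0 + z 1 * b 1 + z 2 * b 2) +
      dotc ζ b * (z 0 * a 0 + z 1 * a 1 + z 2 * a 2)‖ ≤ ‖ζ‖ * n3 z * (n3 a * n3 b) := by
  have ha := bessel ζ z a hz
  have hb := bessel ζ z b hz
  have hζa := dotc_le ζ a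
  have hζb := dotc_le ζ b
  have hza := cs3 z a
  have hzb := cs3 z b
  have htri : ‖dotc ζ a * (z 0 * b 0 + z 1 * b 1 + z 2 * b 2) +
      dotc ζ b * (z 0 * a 0 + z 1 * a 1 + z 2 * a 2)‖ ≤
      ‖dotc ζ a‖ * ‖z 0 * b 0 + z 1 * b 1 + z 2 * b 2‖ +
      ‖dotc ζ b‖ * ‖z 0 * a 0 + z 1 * a 1 + z 2 * a 2‖ := by
    refine (norm_add_le _ _).trans ?_
    rw [norm_mul, norm_mul]
  refine htri.trans ?_
  have n1 := norm_nonneg (dotc ζ a)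
  have n2 := norm_nonneg (dotc ζ b)
  have n4 := norm_nonneg (z 0 * a 0 + z 1 * a 1 + z 2 * a 2)
  have n5 := norm_nonneg (z 0 * b 0 + z 1 * b 1 + z 2 * b 2)
  generalize ‖z 0 * a 0 + z 1 * a 1 + z 2 * a 2‖ = P' at *
  generalize ‖z 0 * b 0 + z 1 * b 1 + z 2 * b 2‖ = Q' at *
  generalize ‖dotc ζ a‖ = P at *
  generalize ‖dotc ζ b‖ = Q at *
  have n6 := n3_nonneg z
  have n7 := n3_nonneg a
  have n8 := n3_nonneg b
  have n9 := norm_nonneg ζ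
  generalize n3 z = Z at *
  generalize n3 a = A at *
  generalize n3 b = B at *
  generalize ‖ζ‖ = X at *
  rcases n6.eq_or_lt with h0 | hZ
  · subst h0
    have : P' = 0 := by linarith
    have : Q' = 0 := by linarith
    subst_vars; simp
  rcases n9.eq_or_lt with h0 | hX
  · subst h0
    have : P = 0 := by linarith
    have : Q = 0 := by linarith
    subst_vars; simp
  have hXZ : 0 < X * Z := by positivity
  have key : (X * Z) * (P * Q' + Q * P') ≤ (X * Z) * (X * Z * (A * B)) := by
    refine (abs_le_of_sq_le_sq' ?_ (by positivity)).2
    have e1 : ((X * Z) * (P * Q' + Q * P')) ^ 2 ≤ (X ^ 2 * P' ^ 2 + Z ^ 2 * P ^ 2) * (X ^ 2 * Q' ^ 2 + Z ^ 2 * Q ^ 2) := by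
      nlinarith [sq_nonneg (X ^ 2 * P' * Q' - Z ^ 2 * P * Q)]
    refine e1.trans ?_
    have e2 : (X * Z * (X * Z * (A * B))) ^ 2 = (X ^ 2 * Z ^ 2 * A ^ 2) * (X ^ 2 * Z ^ 2 * B ^ 2) := by ring
    rw [e2]
    exact mul_le_mul ha hb (by positivity) (by positivity)
  exact le_of_mul_le_mul_left key hXZ

lemma cr_norm (ζ : E3) (z : Fin 3 → ℂ) (hz : dotc ζ z = 0) :
    n3 (cr ζ z) = 2 * π * ‖ζ‖ * n3 z := by
  have hp := Real.pi_pos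
  rw [← sq_eq_sq₀ (n3_nonneg _) (mul_nonneg (by positivity) (n3_nonneg _))]
  have hre : ζ 0 * (z 0).re + ζ 1 * (z 1).re + ζ 2 * (z 2).re = 0 := by
    have := congrArg Complex.re hz; simpa [dotc] using this
  have him : ζ 0 * (z 0).im + ζ 1 * (z 1).im + ζ 2 * (z 2).im = 0 := by
    have := congrArg Complex.im hz; simpa [dotc] using this
  rw [mul_pow, n3_sq, n3_sq, mul_pow, E3_norm_sq]
  simp only [cr, Matrix.cons_val_zero, Matrix.cons_val_one, Matrix.cons_val, norm_mul, mul_pow]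
  simp only [cnorm_sq]
  simp
  linear_combination (-(2 * π) ^ 2 * (ζ 0 * (z 0).re + ζ 1 * (z 1).re + ζ 2 * (z 2).re)) * hre
    + (-(2 * π) ^ 2 * (ζ 0 * (z 0).im + ζ 1 * (z 1).im + ζ 2 * (z 2).im)) * him

lemma gh_le_n3 (z) : gh z ≤ n3 z := by
  apply Real.sqrt_le_sqrt
  nlinarith [sq_nonneg ‖z 2‖]

lemma norm_le_n3 (z : Fin 3 → ℂ) (i : Fin 3) : ‖z i‖ ≤ n3 z := by
  apply Real.le_sqrt_of_sq_le
  fin_cases i <;> simp <;> nlinarith [sq_nonneg ‖z 2‖, sq_nonneg ‖z 1‖, sq_nonneg ‖z 0‖]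

lemma sy_h2 (η : E3) (b : Fin 3 → ℂ) (hb : dotc η b = 0) :
    gh (fun k => sy η b k 2) ≤ 1 / 2 * gh (cr η b) := by
  have hp := Real.pi_pos
  refine (abs_le_of_sq_le_sq' ?_ (mul_nonneg (by norm_num) (gh_nonneg _))).2
  have hre : η 0 * (b 0).re + η 1 * (b 1).re + η 2 * (b 2).re = 0 := by
    have := congrArg Complex.re hb; simpa [dotc] using this
  have him : η 0 * (b 0).im + η 1 * (b 1).im + η 2 * (b 2).im = 0 := by
    have := congrArg Complex.im hb; simpa [dotc] using this
  rw [mul_pow, gh_sq, gh_sq]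
  simp only [cr, sy, Matrix.cons_val_zero, Matrix.cons_val_one, Matrix.cons_val, norm_mul, mul_pow]
  simp only [cnorm_sq]
  simp
  have e1 : 0 ≤ 4 * π ^ 2 * η 2 ^ 2 * ((b 2).re ^ 2 + (b 2).im ^ 2) := by positivity
  have e2 : 4 * π ^ 2 * η 2 * (b 2).re * (η 0 * (b 0).re + η 1 * (b 1).re + η 2 * (b 2).re) = 0 := by
    rw [hre]; ring
  have e3 : 4 * π ^ 2 * η 2 * (b 2).im * (η 0 * (b 0).im + η 1 * (b 1).im + η 2 * (b 2).im) = 0 := by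
    rw [him]; ring
  nlinarith [e1, e2, e3]


/-- Weight `M`. -/
def Mc (c ρ : ℝ) : ℝ := c ^ 2 / (2 * π * ρ) + 2 * π * ρ

/-- Weight `H`. -/
def Hc (c ρ : ℝ) : ℝ := (5 / 4 + c / (8 * (2 * π * ρ))) / (c ^ 2 + (2 * π * ρ) ^ 2) ^ 2

lemma Mc_nonneg {c ρ : ℝ} (hρ : 0 ≤ ρ) : 0 ≤ Mc c ρ := by
  have := Real.pi_pos; unfold Mc; positivity

lemma Hc_nonneg {c ρ : ℝ} (hc : 0 ≤ c) (hρ : 0 ≤ ρ) : 0 ≤ Hc c ρ := by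
  have := Real.pi_pos; unfold Hc; positivity

lemma kap_aux (c r r' : ℝ) (hc : 0 < c) (hr : 0 < r) (h : r ≤ r') :
    (1 / 2 * (1 / r' + 1 / r + 1 / r')) ^ 2 ≤ (c ^ 2 / r + r) * (c ^ 2 / r' + r') *
      ((5 / 4 + c / (8 * r)) / (c ^ 2 + r ^ 2) ^ 2 + (5 / 4 + c / (8 * r')) / (c ^ 2 + r' ^ 2) ^ 2) := by
  have hr' : 0 < r' := hr.trans_le h
  obtain ⟨s, hs⟩ : ∃ s, s = 1 / (c ^ 2 + r ^ 2) := ⟨_, rfl⟩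
  obtain ⟨s', hs'⟩ : ∃ s, s = 1 / (c ^ 2 + r' ^ 2) := ⟨_, rfl⟩
  have hsp : 0 < s := by rw [hs]; positivity
  have hsp' : 0 < s' := by rw [hs']; positivity
  have e1 : (c ^ 2 + r ^ 2) * s = 1 := by rw [hs]; field_simp
  have e2 : (c ^ 2 + r' ^ 2) * s' = 1 := by rw [hs']; field_simp
  have k1 : (1 / 2 * (1 / r' + 1 / r + 1 / r')) ^ 2 = (r / r' + 1 + r' / (4 * r)) / (r * r') := by
    field_simp; ring
  have k2 : (c ^ 2 / r + r) * (c ^ 2 / r' + r') = 1 / (s * s') / (r * r') := by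
    rw [hs, hs']; field_simp
  have k3 : (5 / 4 + c / (8 * r)) / (c ^ 2 + r ^ 2) ^ 2 = (5 / 4 + c / (8 * r)) * s ^ 2 := by
    rw [hs]; field_simp
  have k4 : (5 / 4 + c / (8 * r')) / (c ^ 2 + r' ^ 2) ^ 2 = (5 / 4 + c / (8 * r')) * s' ^ 2 := by
    rw [hs']; field_simp
  rw [k1, k2, k3, k4, div_mul_eq_mul_div]
  apply div_le_div_of_nonneg_right _ (by positivity)
  rw [one_div, inv_mul_eq_div, le_div_iff₀ (by positivity)]
  have l1 : r / r' ≤ 1 := by rw [div_le_one hr']; exact h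
  have l2 : (r' / r) * (s * s') ≤ s ^ 2 * (1 + c / (2 * r)) := by
    have : r' * s' ≤ s * (r + c / 2) := by
      rw [hs, hs', mul_one_div, one_div_mul_eq_div, div_le_div_iff₀ (by positivity) (by positivity)]
      nlinarith [mul_nonneg hr.le (sub_nonneg.2 h), mul_nonneg hc.le (sq_nonneg (c - r')), mul_nonneg (mul_nonneg hr.le hr'.le) (sub_nonneg.2 h), mul_nonneg (sq_nonneg c) (sub_nonneg.2 h), hc, hr, hr', mul_pos hc hr, sq_nonneg (c - 2 * r'), sq_nonneg (c-r'), mul_nonneg hc.le (sq_nonneg (c - r' + r)), mul_nonneg hc.le (sq_nonneg (c - 2 * r'))]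
    have e : (r' / r) * (s * s') = (r' * s') * s / r := by ring
    have e' : s ^ 2 * (1 + c / (2 * r)) = s * (r + c / 2) * s / r := by field_simp
    rw [e, e']
    gcongr
  have l3 : 0 ≤ c / (8 * r') * s' ^ 2 := by positivity
  have l4 : (r / r') * (s * s') ≤ 1 * (s * s') := by gcongr
  have e5 : r' / (4 * r) = (r' / r) / 4 := by field_simp
  have e6 : c / (8 * r) = c / (2 * r) / 4 := by field_simp; norm_num
  rw [e5, e6]
  nlinarith [sq_nonneg (s - s'), sq_nonneg s']

lemma kap (c ρ σ : ℝ) (hc : 0 < c) (hρ : 0 < ρ) (hσ : 0 < σ) :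
    (1 / 2 * (1 / (2 * π) * (1 / max ρ σ + 1 / ρ + 1 / σ))) ^ 2 ≤ Mc c ρ * Mc c σ * (Hc c ρ + Hc c σ) := by
  have hp := Real.pi_pos
  rcases le_total ρ σ with h | h
  · have := kap_aux c (2 * π * ρ) (2 * π * σ) hc (by positivity) (by gcongr)
    rw [max_eq_right h]
    unfold Mc Hc
    refine le_trans (le_of_eq ?_) this
    field_simp
  · have := kap_aux c (2 * π * σ) (2 * π * ρ) hc (by positivity) (by gcongr)
    rw [max_eq_left h]
    unfold Mc Hc
    rw [add_comm ((5 / 4 + c / (8 * (2 * π * ρ))) / _), mul_comm (c ^ 2 / (2 * π * ρ) + _)]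
    refine le_trans (le_of_eq ?_) this
    field_simp; ring

/-- The trilinear integrand. -/
def II (v : E3 → Fin 3 → ℂ) (ξ η : E3) : ℝ :=
  -(1 / (2 * π * ‖ξ‖)) * (star (cr ξ (v ξ) 0) * nlk (ξ - η) η (v (ξ - η)) (v η) 0
    + star (cr ξ (v ξ) 1) * nlk (ξ - η) η (v (ξ - η)) (v η) 1).re

/-- transport part -/
def IIa (ξ η : E3) (a z b : Fin 3 → ℂ) : ℂ :=
  2 * π * Complex.I * (dotc η z * (star (cr ξ a 0) * cr η b 0 + star (cr ξ a 1) * cr η b 1))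

/-- stretching part -/
def IIb (ξ ζ η : E3) (a z b : Fin 3 → ℂ) : ℂ :=
  -((star (cr ξ a 0) * (sy ζ z 0 0 * cr η b 0 + sy ζ z 0 1 * cr η b 1)
    + star (cr ξ a 1) * (sy ζ z 1 0 * cr η b 0 + sy ζ z 1 1 * cr η b 1))
    + (star (cr ξ a 0) * sy η b 0 2 + star (cr ξ a 1) * sy η b 1 2) * cr ζ z 2)

lemma II_split (v : E3 → Fin 3 → ℂ) (ξ η : E3) :
    II v ξ η = -(1 / (2 * π * ‖ξ‖)) * (IIa ξ η (v ξ) (v (ξ - η)) (v η)).re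
      - (1 / (2 * π * ‖ξ‖)) * (IIb ξ (ξ - η) η (v ξ) (v (ξ - η)) (v η)).re := by
  have : (star (cr ξ (v ξ) 0) * nlk (ξ - η) η (v (ξ - η)) (v η) 0
    + star (cr ξ (v ξ) 1) * nlk (ξ - η) η (v (ξ - η)) (v η) 1) =
    IIa ξ η (v ξ) (v (ξ - η)) (v η) + IIb ξ (ξ - η) η (v ξ) (v (ξ - η)) (v η) := by
    unfold nlk IIa IIb; ring
  unfold II
  rw [this, Complex.add_re]; ring

lemma gh_star (w : Fin 3 → ℂ) : gh (fun k => star (w k)) = gh w := by simp [gh]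

lemma IIb_le (ξ ζ η : E3) (a z b : Fin 3 → ℂ) (hz : dotc ζ z = 0) (hb : dotc η b = 0) :
    ‖IIb ξ ζ η a z b‖ ≤ n3 (cr ζ z) * gh (cr ξ a) * gh (cr η b) := by
  have hp := Real.pi_pos
  unfold IIb
  rw [norm_neg]
  refine (norm_add_le _ _).trans ?_
  have h1 := strain_op ζ z ![star (cr ξ a 0), star (cr ξ a 1), 0] ![cr η b 0, cr η b 1, 0] hz
  have e1 : n3 ![star (cr ξ a 0), star (cr ξ a 1), 0] = gh (cr ξ a) := by simp [n3, gh]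
  have e2 : n3 ![cr η b 0, cr η b 1, 0] = gh (cr η b) := by simp [n3, gh]
  rw [e1, e2] at h1
  have e3 : (star (cr ξ a 0) * (sy ζ z 0 0 * cr η b 0 + sy ζ z 0 1 * cr η b 1)
    + star (cr ξ a 1) * (sy ζ z 1 0 * cr η b 0 + sy ζ z 1 1 * cr η b 1)) = π * Complex.I *
     (dotc ζ ![star (cr ξ a 0), star (cr ξ a 1), 0] * (z 0 * ![cr η b 0, cr η b 1, 0] 0 + z 1 * ![cr η b 0, cr η b 1, 0] 1 + z 2 * ![cr η b 0, cr η b 1, 0] 2) +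
      dotc ζ ![cr η b 0, cr η b 1, 0] * (z 0 * ![star (cr ξ a 0), star (cr ξ a 1), 0] 0 + z 1 * ![star (cr ξ a 0), star (cr ξ a 1), 0] 1 + z 2 * ![star (cr ξ a 0), star (cr ξ a 1), 0] 2)) := by
    simp [dotc, sy]; ring
  have h2 : ‖(star (cr ξ a 0) * (sy ζ z 0 0 * cr η b 0 + sy ζ z 0 1 * cr η b 1)
    + star (cr ξ a 1) * (sy ζ z 1 0 * cr η b 0 + sy ζ z 1 1 * cr η b 1))‖ ≤
      1 / 2 * (n3 (cr ζ z) * gh (cr ξ a) * gh (cr η b)) := by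
    rw [e3, norm_mul, cr_norm ζ z hz]
    have : ‖(π : ℂ) * Complex.I‖ = π := by simp [abs_of_pos hp]
    rw [this]
    nlinarith
  have h3 : ‖(star (cr ξ a 0) * sy η b 0 2 + star (cr ξ a 1) * sy η b 1 2) * cr ζ z 2‖ ≤
      1 / 2 * (n3 (cr ζ z) * gh (cr ξ a) * gh (cr η b)) := by
    rw [norm_mul]
    have i1 := cs2 (fun k => star (cr ξ a k)) (fun k => sy η b k 2)
    rw [gh_star] at i1
    have i2 := sy_h2 η b hb
    have i3 := norm_le_n3 (cr ζ z) 2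
    calc _ ≤ (gh (cr ξ a) * (1 / 2 * gh (cr η b))) * n3 (cr ζ z) := by
          refine mul_le_mul (i1.trans ?_) i3 (norm_nonneg _) ?_
          · exact mul_le_mul_of_nonneg_left i2 (gh_nonneg _)
          · exact mul_nonneg (gh_nonneg _) (mul_nonneg (by norm_num) (gh_nonneg _))
      _ = _ := by ring
  linarith

lemma II_pt (v : E3 → Fin 3 → ℂ) (hdiv : ∀ ξ, dotc ξ (v ξ) = 0)
    (hconj : ∀ ξ i, v (-ξ) i = star (v ξ i)) (ξ η : E3) :
    |II v ξ η + II v η ξ| ≤ n3 (cr (ξ - η) (v (ξ - η))) * gh (cr ξ (v ξ)) * gh (cr η (v η)) *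
      (1 / (2 * π) * (1 / max ‖ξ‖ ‖η‖ + 1 / ‖ξ‖ + 1 / ‖η‖)) := by
  have hp := Real.pi_pos
  have hR : 0 ≤ n3 (cr (ξ - η) (v (ξ - η))) * gh (cr ξ (v ξ)) * gh (cr η (v η)) *
      (1 / (2 * π) * (1 / max ‖ξ‖ ‖η‖ + 1 / ‖ξ‖ + 1 / ‖η‖)) := by
    have := n3_nonneg (cr (ξ - η) (v (ξ - η)))
    have := gh_nonneg (cr ξ (v ξ))
    have := gh_nonneg (cr η (v η))
    positivity
  rcases eq_or_ne ξ 0 with h0 | hξ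
  · subst h0
    refine le_trans (le_of_eq ?_) hR
    simp [II, nlk, cr, sy, dotc]
  rcases eq_or_ne η 0 with h0 | hη
  · subst h0
    refine le_trans (le_of_eq ?_) hR
    simp [II, nlk, cr, sy, dotc]
  have hρ : 0 < ‖ξ‖ := norm_pos_iff.2 hξ
  have hσ : 0 < ‖η‖ := norm_pos_iff.2 hη
  have hz' : ∀ i, v (η - ξ) i = star (v (ξ - η) i) := by
    intro i; rw [← hconj]; congr 2; abel
  have hU : n3 (cr (η - ξ) (v (η - ξ))) = n3 (cr (ξ - η) (v (ξ - η))) := by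
    rw [cr_norm _ _ (hdiv _), cr_norm _ _ (hdiv _), norm_sub_rev]
    congr 1
    simp [n3, hz']
  have hb1 := IIb_le ξ (ξ - η) η (v ξ) (v (ξ - η)) (v η) (hdiv _) (hdiv _)
  have hb2 := IIb_le η (η - ξ) ξ (v η) (v (η - ξ)) (v ξ) (hdiv _) (hdiv _)
  rw [hU] at hb2
  set q : ℂ := dotc η (v (ξ - η)) * (star (cr ξ (v ξ) 0) * cr η (v η) 0 + star (cr ξ (v ξ) 1) * cr η (v η) 1) with hq
  have hze : dotc ξ (v (ξ - η)) = dotc η (v (ξ - η)) := by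
    have := hdiv (ξ - η)
    have e : dotc (ξ - η) (v (ξ - η)) = dotc ξ (v (ξ - η)) - dotc η (v (ξ - η)) := by
      simp [dotc]; ring
    rw [e] at this
    exact sub_eq_zero.1 this
  have ha1 : (IIa ξ η (v ξ) (v (ξ - η)) (v η)).re = -(2 * π * q.im) := by
    have : IIa ξ η (v ξ) (v (ξ - η)) (v η) = ((2 * π : ℝ) : ℂ) * (Complex.I * q) := by
      simp only [IIa, hq]; push_cast; ring
    rw [this, Complex.re_ofReal_mul, Complex.I_mul_re]; ring
  have ha2 : (IIa η ξ (v η) (v (η - ξ)) (v ξ)).re = 2 * π * q.im := by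
    have e1 : dotc ξ (v (η - ξ)) = star (dotc η (v (ξ - η))) := by
      rw [← hze]; simp [dotc, hz']
    have : IIa η ξ (v η) (v (η - ξ)) (v ξ) = ((2 * π : ℝ) : ℂ) * (Complex.I * star q) := by
      simp only [IIa, hq, e1]
      simp only [star_mul', star_add, star_star]; push_cast; ring
    rw [this, Complex.re_ofReal_mul, Complex.I_mul_re]; simp
  rw [II_split, II_split, ha1, ha2]
  have hqle : ‖q‖ ≤ min ‖ξ‖ ‖η‖ * n3 (v (ξ - η)) * (gh (cr ξ (v ξ)) * gh (cr η (v η))) := by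
    rw [hq, norm_mul]
    refine mul_le_mul ?_ ?_ (norm_nonneg _) (mul_nonneg (by positivity) (n3_nonneg _))
    · rw [min_mul_of_nonneg _ _ (n3_nonneg _)]
      refine le_min ?_ (dotc_le _ _)
      rw [← hze]; exact dotc_le _ _
    · have := cs2 (fun k => star (cr ξ (v ξ) k)) (cr η (v η))
      rwa [gh_star] at this
  set U := n3 (cr (ξ - η) (v (ξ - η))) with hUd
  have hUe : U = 2 * π * ‖ξ - η‖ * n3 (v (ξ - η)) := cr_norm _ _ (hdiv _)
  have hA : |(1 / ‖ξ‖ - 1 / ‖η‖) * q.im| ≤ U * gh (cr ξ (v ξ)) * gh (cr η (v η)) * (1 / (2 * π) * (1 / max ‖ξ‖ ‖η‖)) := by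
    rw [abs_mul]
    have i1 : |q.im| ≤ ‖q‖ := Complex.abs_im_le_norm q
    have i2 : |1 / ‖ξ‖ - 1 / ‖η‖| ≤ ‖ξ - η‖ / (‖ξ‖ * ‖η‖) := by
      have : 1 / ‖ξ‖ - 1 / ‖η‖ = (‖η‖ - ‖ξ‖) / (‖ξ‖ * ‖η‖) := by field_simp
      rw [this, abs_div, abs_of_pos (mul_pos hρ hσ)]
      gcongr
      rw [norm_sub_rev]
      exact abs_norm_sub_norm_le _ _
    have i3 : ‖ξ‖ * ‖η‖ = max ‖ξ‖ ‖η‖ * min ‖ξ‖ ‖η‖ := (max_mul_min _ _).symm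
    have hmx : 0 < max ‖ξ‖ ‖η‖ := lt_max_of_lt_left hρ
    have hmn : 0 < min ‖ξ‖ ‖η‖ := lt_min hρ hσ
    calc _ ≤ ‖ξ - η‖ / (‖ξ‖ * ‖η‖) * (min ‖ξ‖ ‖η‖ * n3 (v (ξ - η)) * (gh (cr ξ (v ξ)) * gh (cr η (v η)))) :=
          mul_le_mul i2 (i1.trans hqle) (abs_nonneg _) (by positivity)
      _ = _ := by
          rw [i3, hUe]; field_simp
  have hB1 : |(IIb ξ (ξ - η) η (v ξ) (v (ξ - η)) (v η)).re| ≤ U * gh (cr ξ (v ξ)) * gh (cr η (v η)) :=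
    (Complex.abs_re_le_norm _).trans hb1
  have hB2 : |(IIb η (η - ξ) ξ (v η) (v (η - ξ)) (v ξ)).re| ≤ U * gh (cr ξ (v ξ)) * gh (cr η (v η)) := by
    refine (Complex.abs_re_le_norm _).trans (hb2.trans (le_of_eq ?_)); ring
  generalize (IIb ξ (ξ - η) η (v ξ) (v (ξ - η)) (v η)).re = B1 at *
  generalize (IIb η (η - ξ) ξ (v η) (v (η - ξ)) (v ξ)).re = B2 at *
  have e : -(1 / (2 * π * ‖ξ‖)) * -(2 * π * q.im) - 1 / (2 * π * ‖ξ‖) * B1 +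
      (-(1 / (2 * π * ‖η‖)) * (2 * π * q.im) - 1 / (2 * π * ‖η‖) * B2)
      = (1 / ‖ξ‖ - 1 / ‖η‖) * q.im + (-(1 / (2 * π * ‖ξ‖) * B1) + -(1 / (2 * π * ‖η‖) * B2)) := by
    field_simp; ring
  rw [e]
  refine (abs_add_le _ _).trans ((add_le_add hA (abs_add_le _ _)).trans ?_)
  rw [abs_neg, abs_neg, abs_mul, abs_mul, abs_of_pos (show 0 < 1 / (2 * π * ‖ξ‖) by positivity),
    abs_of_pos (show 0 < 1 / (2 * π * ‖η‖) by positivity)]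
  have j1 := mul_le_mul_of_nonneg_left hB1 (show 0 ≤ 1 / (2 * π * ‖ξ‖) by positivity)
  have j2 := mul_le_mul_of_nonneg_left hB2 (show 0 ≤ 1 / (2 * π * ‖η‖) by positivity)
  have e' : U * gh (cr ξ (v ξ)) * gh (cr η (v η)) *
      (1 / (2 * π) * (1 / max ‖ξ‖ ‖η‖ + 1 / ‖ξ‖ + 1 / ‖η‖)) =
      U * gh (cr ξ (v ξ)) * gh (cr η (v η)) * (1 / (2 * π) * (1 / max ‖ξ‖ ‖η‖))
      + (1 / (2 * π * ‖ξ‖) * (U * gh (cr ξ (v ξ)) * gh (cr η (v η)))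
      + 1 / (2 * π * ‖η‖) * (U * gh (cr ξ (v ξ)) * gh (cr η (v η)))) := by
    field_simp
    ring
  rw [e']
  linarith

lemma II_bound (v : E3 → Fin 3 → ℂ) (hdiv : ∀ ξ, dotc ξ (v ξ) = 0)
    (hconj : ∀ ξ i, v (-ξ) i = star (v ξ i)) (c l : ℝ) (hc : 0 < c) (hl : 0 < l) (ξ η : E3) :
    |II v ξ η + II v η ξ| ≤ l * (n3 (cr (ξ - η) (v (ξ - η))) ^ 2 * (Hc c ‖ξ‖ + Hc c ‖η‖))
      + l⁻¹ * ((gh (cr ξ (v ξ)) ^ 2 * Mc c ‖ξ‖) * (gh (cr η (v η)) ^ 2 * Mc c ‖η‖)) := by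
  have hp := Real.pi_pos
  have hH1 := Hc_nonneg hc.le (norm_nonneg ξ)
  have hH2 := Hc_nonneg hc.le (norm_nonneg η)
  have hM1 := Mc_nonneg (c := c) (norm_nonneg ξ)
  have hM2 := Mc_nonneg (c := c) (norm_nonneg η)
  refine (II_pt v hdiv hconj ξ η).trans ?_
  have hR : 0 ≤ l * (n3 (cr (ξ - η) (v (ξ - η))) ^ 2 * (Hc c ‖ξ‖ + Hc c ‖η‖))
      + l⁻¹ * ((gh (cr ξ (v ξ)) ^ 2 * Mc c ‖ξ‖) * (gh (cr η (v η)) ^ 2 * Mc c ‖η‖)) := by positivity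
  rcases eq_or_ne ξ 0 with h0 | hξ
  · subst h0
    refine le_trans (le_of_eq ?_) hR
    simp [cr, gh]
  rcases eq_or_ne η 0 with h0 | hη
  · subst h0
    refine le_trans (le_of_eq ?_) hR
    simp [cr, gh]
  have hk := kap c ‖ξ‖ ‖η‖ hc (norm_pos_iff.2 hξ) (norm_pos_iff.2 hη)
  generalize 1 / (2 * π) * (1 / max ‖ξ‖ ‖η‖ + 1 / ‖ξ‖ + 1 / ‖η‖) = κ at *
  generalize n3 (cr (ξ - η) (v (ξ - η))) = U at *
  generalize gh (cr ξ (v ξ)) = g at *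
  generalize gh (cr η (v η)) = g' at *
  generalize Mc c ‖ξ‖ = M at *
  generalize Mc c ‖η‖ = M' at *
  have hHs : 0 ≤ Hc c ‖ξ‖ + Hc c ‖η‖ := add_nonneg hH1 hH2
  generalize Hc c ‖ξ‖ + Hc c ‖η‖ = H at *
  refine (abs_le_of_sq_le_sq' ?_ hR).2
  have e1 : (l * (U ^ 2 * H) + l⁻¹ * (g ^ 2 * M * (g' ^ 2 * M'))) ^ 2 ≥
      4 * ((U ^ 2 * H) * (g ^ 2 * M * (g' ^ 2 * M'))) := by
    have : (l * (U ^ 2 * H) + l⁻¹ * (g ^ 2 * M * (g' ^ 2 * M'))) ^ 2 =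
      4 * ((U ^ 2 * H) * (g ^ 2 * M * (g' ^ 2 * M')))
       + (l * (U ^ 2 * H) - l⁻¹ * (g ^ 2 * M * (g' ^ 2 * M'))) ^ 2 := by
      field_simp; ring
    rw [this]
    nlinarith [sq_nonneg (l * (U ^ 2 * H) - l⁻¹ * (g ^ 2 * M * (g' ^ 2 * M')))]
  refine le_trans ?_ e1
  have := mul_le_mul_of_nonneg_left hk (show 0 ≤ 4 * (U ^ 2 * g ^ 2 * g' ^ 2) by positivity)
  refine (le_of_eq ?_).trans (this.trans (le_of_eq ?_)) <;> ring


/-- Antiderivative for the radial integral of `Hc`. -/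
def FH (c a y : ℝ) : ℝ :=
  5 / 4 * (-(y / (2 * a ^ 2 * (c ^ 2 + (a * y) ^ 2))) + Real.arctan (a * y / c) / (2 * a ^ 3 * c))
    + c / (8 * a) * (-(1 / (2 * a ^ 2 * (c ^ 2 + (a * y) ^ 2))))

lemma FH_deriv (c a y : ℝ) (hc : 0 < c) (ha : 0 < a) :
    HasDerivAt (FH c a)
      (5 / 4 * (y ^ 2 / (c ^ 2 + (a * y) ^ 2) ^ 2) + c / (8 * a) * (y / (c ^ 2 + (a * y) ^ 2) ^ 2)) y := by
  have hD : HasDerivAt (fun y : ℝ => 2 * a ^ 2 * (c ^ 2 + (a * y) ^ 2)) (2 * a ^ 2 * (2 * (a * y) * a)) y := by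
    have h1 : HasDerivAt (fun y : ℝ => a * y) a y := by simpa using (hasDerivAt_id y).const_mul a
    have := ((h1.pow 2).const_add (c ^ 2)).const_mul (2 * a ^ 2)
    refine this.congr_deriv ?_
    simp
  have hpos : 0 < c ^ 2 + (a * y) ^ 2 := by positivity
  have hne : 2 * a ^ 2 * (c ^ 2 + (a * y) ^ 2) ≠ 0 := by positivity
  have h1 : HasDerivAt (fun y : ℝ => y / (2 * a ^ 2 * (c ^ 2 + (a * y) ^ 2))) _ y :=
    (hasDerivAt_id y).div hD hne
  have h2 : HasDerivAt (fun y : ℝ => 1 / (2 * a ^ 2 * (c ^ 2 + (a * y) ^ 2))) _ y :=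
    (hasDerivAt_const y (1 : ℝ)).div hD hne
  have h3 : HasDerivAt (fun y : ℝ => a * y / c) (a / c) y := by
    simpa using ((hasDerivAt_id y).const_mul a).div_const c
  have h4 := (h3.arctan).div_const (2 * a ^ 3 * c)
  have := ((h1.neg.add h4).const_mul (5 / 4)).add (h2.neg.const_mul (c / (8 * a)))
  refine (this.congr_deriv ?_)
  have h5 : 1 + (a * y / c) ^ 2 = (c ^ 2 + (a * y) ^ 2) / c ^ 2 := by field_simp
  rw [h5]
  simp only [id]
  field_simp
  ring

lemma FH_tendsto (c a : ℝ) (hc : 0 < c) (ha : 0 < a) :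
    Filter.Tendsto (FH c a) Filter.atTop (nhds (5 / 4 * (-0 + (π / 2) / (2 * a ^ 3 * c)) + c / (8 * a) * (-0))) := by
  have hlin : Filter.Tendsto (fun y : ℝ => a * y / c) Filter.atTop Filter.atTop := by
    have : (fun y : ℝ => a * y / c) = fun y => (a / c) * y := by ext; ring
    rw [this]; exact Filter.tendsto_id.const_mul_atTop (by positivity)
  have h4 : Filter.Tendsto (fun y : ℝ => Real.arctan (a * y / c)) Filter.atTop (nhds (π / 2)) :=
    ((Real.tendsto_arctan_atTop).mono_right nhdsWithin_le_nhds).comp hlin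
  have h0 : Filter.Tendsto (fun y : ℝ => (1 / (2 * a ^ 4)) * y⁻¹) Filter.atTop (nhds 0) := by
    have := (tendsto_inv_atTop_zero (𝕜 := ℝ)).const_mul (1 / (2 * a ^ 4))
    rwa [mul_zero] at this
  have h1 : Filter.Tendsto (fun y : ℝ => y / (2 * a ^ 2 * (c ^ 2 + (a * y) ^ 2))) Filter.atTop (nhds 0) := by
    refine squeeze_zero' ?_ ?_ h0
    · filter_upwards [Filter.eventually_gt_atTop 0] with y hy; positivity
    · filter_upwards [Filter.eventually_gt_atTop 0] with y hy
      rw [div_le_iff₀ (by positivity)]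
      field_simp
      nlinarith [sq_nonneg c]
  have h2 : Filter.Tendsto (fun y : ℝ => 1 / (2 * a ^ 2 * (c ^ 2 + (a * y) ^ 2))) Filter.atTop (nhds 0) := by
    refine squeeze_zero' ?_ ?_ h0
    · filter_upwards with y; positivity
    · filter_upwards [Filter.eventually_ge_atTop 1] with y hy
      have : 0 < y := by linarith
      rw [div_le_iff₀ (by positivity)]
      field_simp
      nlinarith [sq_nonneg c, mul_le_mul_of_nonneg_left hy (show 0 ≤ y * a ^ 2 by positivity)]
  exact (((h1.neg.add (h4.div_const _)).const_mul _).add (h2.neg.const_mul _))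

lemma Hc_int (c : ℝ) (hc : 0 < c) :
    Integrable (fun ξ : E3 => Hc c ‖ξ‖) ∧ ∫ ξ : E3, Hc c ‖ξ‖ = (5 * π + 1) / (32 * π ^ 2 * c) := by
  have hp := Real.pi_pos
  have ha : 0 < 2 * π := by positivity
  have hcg : ∀ y ∈ Set.Ioi (0 : ℝ), (5 / 4 * (y ^ 2 / (c ^ 2 + (2 * π * y) ^ 2) ^ 2) +
      c / (8 * (2 * π)) * (y / (c ^ 2 + (2 * π * y) ^ 2) ^ 2)) = y ^ (Module.finrank ℝ E3 - 1) • Hc c y := by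
    intro y hy
    have hy : 0 < y := hy
    simp only [Hc, finrank_euclideanSpace, Fintype.card_fin, smul_eq_mul]
    norm_num
    field_simp
  have hnn : ∀ y ∈ Set.Ioi (0 : ℝ), 0 ≤ (5 / 4 * (y ^ 2 / (c ^ 2 + (2 * π * y) ^ 2) ^ 2) +
      c / (8 * (2 * π)) * (y / (c ^ 2 + (2 * π * y) ^ 2) ^ 2)) := by
    intro y hy
    have hy : 0 < y := hy
    positivity
  have hi := integrableOn_Ioi_deriv_of_nonneg' (fun y _ => FH_deriv c (2 * π) y hc ha) hnn (FH_tendsto c (2 * π) hc ha)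
  have hv := integral_Ioi_of_hasDerivAt_of_nonneg' (fun y _ => FH_deriv c (2 * π) y hc ha) hnn (FH_tendsto c (2 * π) hc ha)
  constructor
  · rw [integrable_fun_norm_addHaar volume (f := Hc c)]
    exact hi.congr_fun hcg measurableSet_Ioi
  · rw [integral_fun_norm_addHaar volume (Hc c), ← setIntegral_congr_fun measurableSet_Ioi hcg, hv]
    have hvol : (volume : Measure E3).real (Metric.ball 0 1) = π * 4 / 3 := by
      rw [Measure.real, EuclideanSpace.volume_ball_fin_three]
      simp; positivity
    rw [hvol]
    simp [FH]
    field_simp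
    ring


lemma opt_l (N A G : ℝ) (hA : 0 ≤ A) (hG : 0 ≤ G)
    (h : ∀ l : ℝ, 0 < l → N ≤ 1 / 2 * (l * A ^ 2 + l⁻¹ * G ^ 2)) : N ≤ A * G := by
  have h1 : ∀ ε : ℝ, 0 < ε → N ≤ (A + ε) * (G + ε) := by
    intro ε hε
    have hA' : 0 < A + ε := by linarith
    have hG' : 0 < G + ε := by linarith
    refine (h ((G + ε) / (A + ε)) (by positivity)).trans ?_
    have i1 : (G + ε) / (A + ε) * A ^ 2 ≤ (G + ε) / (A + ε) * (A + ε) ^ 2 := by gcongr; linarith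
    have i2 : ((G + ε) / (A + ε))⁻¹ * G ^ 2 ≤ ((G + ε) / (A + ε))⁻¹ * (G + ε) ^ 2 := by gcongr; linarith
    have i3 : (G + ε) / (A + ε) * (A + ε) ^ 2 = (A + ε) * (G + ε) := by field_simp
    have i4 : ((G + ε) / (A + ε))⁻¹ * (G + ε) ^ 2 = (A + ε) * (G + ε) := by field_simp
    linarith
  have ht : Filter.Tendsto (fun ε : ℝ => (A + ε) * (G + ε)) (nhdsWithin 0 (Set.Ioi 0)) (nhds (A * G)) := by
    have : Filter.Tendsto (fun ε : ℝ => (A + ε) * (G + ε)) (nhds 0) (nhds ((A + 0) * (G + 0))) := by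
      apply Continuous.tendsto; fun_prop
    simp only [add_zero] at this
    exact this.mono_left nhdsWithin_le_nhds
  exact ge_of_tendsto ht (Filter.eventually_of_mem self_mem_nhdsWithin h1)

/-- the constant -/
def CC : ℝ := (5 * π + 1) / (16 * π ^ 2)

lemma CC_pos : 0 < CC := by have := Real.pi_pos; unfold CC; positivity

lemma n3_sym (v : E3 → Fin 3 → ℂ) (hdiv : ∀ ξ, dotc ξ (v ξ) = 0)
    (hconj : ∀ ξ i, v (-ξ) i = star (v ξ i)) (ξ : E3) :
    n3 (cr (-ξ) (v (-ξ))) = n3 (cr ξ (v ξ)) := by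
  rw [cr_norm _ _ (hdiv _), cr_norm _ _ (hdiv _), norm_neg]
  congr 1
  simp [n3, hconj]

lemma N_cl (v : E3 → Fin 3 → ℂ) (hdiv : ∀ ξ, dotc ξ (v ξ) = 0)
    (hconj : ∀ ξ i, v (-ξ) i = star (v ξ i))
    (hII : Integrable (fun p : E3 × E3 => II v p.1 p.2) (volume.prod volume))
    (hU : Integrable (fun ξ => n3 (cr ξ (v ξ)) ^ 2))
    (hx : Integrable (fun ξ => gh (cr ξ (v ξ)) ^ 2 * (1 / (2 * π * ‖ξ‖))))
    (hy : Integrable (fun ξ => gh (cr ξ (v ξ)) ^ 2 * (2 * π * ‖ξ‖)))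
    (c l : ℝ) (hc : 0 < c) (hl : 0 < l) :
    ∫ ξ, ∫ η, II v ξ η ≤ 1 / 2 * (l * (CC / c * ∫ ξ, n3 (cr ξ (v ξ)) ^ 2) + l⁻¹ *
      (c ^ 2 * (∫ ξ, gh (cr ξ (v ξ)) ^ 2 * (1 / (2 * π * ‖ξ‖))) +
        ∫ ξ, gh (cr ξ (v ξ)) ^ 2 * (2 * π * ‖ξ‖)) ^ 2) := by
  have hp := Real.pi_pos
  obtain ⟨hHi, hHv⟩ := Hc_int c hc
  set G : E3 → ℝ := fun ξ => gh (cr ξ (v ξ)) ^ 2 * Mc c ‖ξ‖ with hGd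
  have hGe : G = fun ξ => c ^ 2 * (gh (cr ξ (v ξ)) ^ 2 * (1 / (2 * π * ‖ξ‖))) + gh (cr ξ (v ξ)) ^ 2 * (2 * π * ‖ξ‖) := by
    ext ξ; simp only [hGd, Mc]; ring
  have hGi : Integrable G := by rw [hGe]; exact (hx.const_mul _).add hy
  have hGv : ∫ ξ, G ξ = c ^ 2 * (∫ ξ, gh (cr ξ (v ξ)) ^ 2 * (1 / (2 * π * ‖ξ‖))) +
        ∫ ξ, gh (cr ξ (v ξ)) ^ 2 * (2 * π * ‖ξ‖) := by
    rw [hGe, integral_add (hx.const_mul _) hy, integral_const_mul]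
  have hGG : Integrable (fun p : E3 × E3 => G p.1 * G p.2) (volume.prod volume) := hGi.mul_prod hGi
  have hGGv : ∫ p : E3 × E3, G p.1 * G p.2 ∂(volume.prod volume) = (∫ ξ, G ξ) ^ 2 := by
    rw [integral_prod_mul, sq]
  set B : E3 × E3 → ℝ := fun p => n3 (cr (p.1 - p.2) (v (p.1 - p.2))) ^ 2 * Hc c ‖p.2‖ with hBd
  have hBi : Integrable B (volume.prod volume) := by
    have := Integrable.convolution_integrand (ContinuousLinearMap.mul ℝ ℝ) hHi hU
    refine this.congr (Filter.Eventually.of_forall fun p => ?_)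
    simp [hBd, mul_comm]
  have hBv : ∫ p, B p ∂(volume.prod volume) = CC / (2 * c) * ∫ ξ, n3 (cr ξ (v ξ)) ^ 2 := by
    rw [integral_prod _ hBi]
    have := integral_convolution (μ := volume) (ν := volume) (ContinuousLinearMap.mul ℝ ℝ) hHi hU
    simp only [convolution_def, ContinuousLinearMap.mul_apply', hHv] at this
    have e : (5 * π + 1) / (32 * π ^ 2 * c) = CC / (2 * c) := by unfold CC; field_simp; norm_num
    rw [← e, ← this]
    simp [hBd, mul_comm]
  have hBs : Integrable (fun p : E3 × E3 => B p.swap) (volume.prod volume) := hBi.swap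
  have hBsv : ∫ p : E3 × E3, B p.swap ∂(volume.prod volume) = ∫ p, B p ∂(volume.prod volume) :=
    integral_prod_swap B
  have hIIs : Integrable (fun p : E3 × E3 => II v p.2 p.1) (volume.prod volume) := hII.swap
  have hIIsv : ∫ p : E3 × E3, II v p.2 p.1 ∂(volume.prod volume) = ∫ p : E3 × E3, II v p.1 p.2 ∂(volume.prod volume) :=
    integral_prod_swap (fun p : E3 × E3 => II v p.1 p.2)
  have key : ∫ p : E3 × E3, (II v p.1 p.2 + II v p.2 p.1) ∂(volume.prod volume) ≤
      ∫ p : E3 × E3, (l * (B p + B p.swap) + l⁻¹ * (G p.1 * G p.2)) ∂(volume.prod volume) := by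
    refine integral_mono (hII.add hIIs) (((hBi.add hBs).const_mul l).add (hGG.const_mul _)) ?_
    intro p
    refine (le_abs_self _).trans ((II_bound v hdiv hconj c l hc hl p.1 p.2).trans (le_of_eq ?_))
    have : n3 (cr (p.2 - p.1) (v (p.2 - p.1))) = n3 (cr (p.1 - p.2) (v (p.1 - p.2))) := by
      rw [← n3_sym v hdiv hconj, neg_sub]
    simp only [hBd, hGd, Prod.swap, this]
    ring
  have hBB : Integrable (fun p : E3 × E3 => B p + B p.swap) (volume.prod volume) := hBi.add hBs
  rw [integral_add hII hIIs, hIIsv, integral_add (hBB.const_mul l) (hGG.const_mul _),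
    integral_const_mul, integral_const_mul, integral_add hBi hBs, hBsv, hBv, hGGv, hGv, integral_prod _ hII] at key
  have e : CC / c = 2 * (CC / (2 * c)) := by field_simp
  rw [e]
  linarith

lemma N_bound (v : E3 → Fin 3 → ℂ) (hdiv : ∀ ξ, dotc ξ (v ξ) = 0)
    (hconj : ∀ ξ i, v (-ξ) i = star (v ξ i))
    (hII : Integrable (fun p : E3 × E3 => II v p.1 p.2) (volume.prod volume))
    (hU : Integrable (fun ξ => n3 (cr ξ (v ξ)) ^ 2))
    (hx : Integrable (fun ξ => gh (cr ξ (v ξ)) ^ 2 * (1 / (2 * π * ‖ξ‖))))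
    (hy : Integrable (fun ξ => gh (cr ξ (v ξ)) ^ 2 * (2 * π * ‖ξ‖)))
    (ν : ℝ) (hν : 0 < ν) :
    ∫ ξ, ∫ η, II v ξ η ≤ ν * (∫ ξ, gh (cr ξ (v ξ)) ^ 2 * (2 * π * ‖ξ‖)) +
      CC ^ 2 * (∫ ξ, n3 (cr ξ (v ξ)) ^ 2) ^ 2 / ν ^ 3 *
        ∫ ξ, gh (cr ξ (v ξ)) ^ 2 * (1 / (2 * π * ‖ξ‖)) := by
  have hp := Real.pi_pos
  have hN := N_cl v hdiv hconj hII hU hx hy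
  have hE0 : 0 ≤ ∫ ξ, n3 (cr ξ (v ξ)) ^ 2 := integral_nonneg fun ξ => by positivity
  have hx0 : 0 ≤ ∫ ξ, gh (cr ξ (v ξ)) ^ 2 * (1 / (2 * π * ‖ξ‖)) := integral_nonneg fun ξ => by positivity
  have hy0 : 0 ≤ ∫ ξ, gh (cr ξ (v ξ)) ^ 2 * (2 * π * ‖ξ‖) := integral_nonneg fun ξ => by positivity
  generalize (∫ ξ, n3 (cr ξ (v ξ)) ^ 2) = E at *
  generalize (∫ ξ, gh (cr ξ (v ξ)) ^ 2 * (1 / (2 * π * ‖ξ‖))) = X at *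
  generalize (∫ ξ, gh (cr ξ (v ξ)) ^ 2 * (2 * π * ‖ξ‖)) = Y at *
  have hC := CC_pos
  rcases hE0.eq_or_lt with h0 | hE
  · subst h0
    have := opt_l _ 0 (1 ^ 2 * X + Y) le_rfl (by positivity) (fun l hl => by
      have := hN 1 l one_pos hl
      simpa using this)
    refine this.trans ?_
    rw [zero_mul]; positivity
  · have hc : 0 < CC * E / ν ^ 2 := by positivity
    have := opt_l _ ν ((CC * E / ν ^ 2) ^ 2 * X + Y) hν.le (by positivity) (fun l hl => by
      have := hN _ l hc hl
      refine this.trans (le_of_eq ?_)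
      congr 3
      field_simp)
    refine this.trans (le_of_eq ?_)
    field_simp
    ring


open LineDeriv in
/-- Partial derivative on Schwartz functions. -/
def pdS (i : Fin 3) (f : 𝓢(E3, ℝ)) : 𝓢(E3, ℝ) := ∂_{ee i} f

/-- Complexification and Fourier transform. -/
def hat : 𝓢(E3, ℝ) →L[ℝ] 𝓢(E3, ℂ) :=
  (FourierTransform.fourierCLM ℝ 𝓢(E3, ℂ)).comp (postcompCLM Complex.ofRealCLM)

/-- product -/
def mulS (f g : 𝓢(E3, ℝ)) : 𝓢(E3, ℝ) := pairing (ContinuousLinearMap.mul ℝ ℝ) f g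

lemma pdS_coe (i : Fin 3) (f : 𝓢(E3, ℝ)) : ⇑(pdS i f) = pd i f := by
  ext x; exact lineDerivOp_apply_eq_fderiv _ _ _

lemma mulS_apply (f g : 𝓢(E3, ℝ)) (x : E3) : mulS f g x = f x * g x := by
  simp [mulS]

lemma hat_eq (f : 𝓢(E3, ℝ)) : hat f = 𝓕 (postcompCLM Complex.ofRealCLM f) := rfl

lemma hat_ft (f : 𝓢(E3, ℝ)) : ft f = hat f := by
  rw [hat_eq, fourier_coe]; rfl

lemma hat_apply (f : 𝓢(E3, ℝ)) (ξ : E3) :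
    hat f ξ = ∫ x : E3, 𝐞 (-(inner ℝ x ξ)) • (f x : ℂ) := by
  rw [← hat_ft]; rfl

lemma hat_conj (f : 𝓢(E3, ℝ)) (ξ : E3) : hat f (-ξ) = star (hat f ξ) := by
  rw [hat_apply, hat_apply, Complex.star_def, ← integral_conj]
  congr 1; ext x
  rw [Circle.smul_def, Circle.smul_def, smul_eq_mul, smul_eq_mul, map_mul, Complex.conj_ofReal, inner_neg_right, neg_neg]
  congr 1
  rw [Real.fourierChar_apply, Real.fourierChar_apply, ← Complex.exp_conj]
  simp [show (starRingEnd ℂ) 2 = 2 from map_ofNat _ 2]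

open LineDeriv in
lemma hat_pdS (i : Fin 3) (f : 𝓢(E3, ℝ)) (ξ : E3) :
    hat (pdS i f) ξ = 2 * π * Complex.I * ξ i * hat f ξ := by
  have h1 : postcompCLM Complex.ofRealCLM (pdS i f) = ∂_{ee i} (postcompCLM Complex.ofRealCLM f) := by
    ext x
    rw [postcompCLM_apply, lineDerivOp_apply_eq_fderiv, pdS_coe]
    have : (⇑(postcompCLM Complex.ofRealCLM f) : E3 → ℂ) = Complex.ofRealCLM ∘ f := rfl
    rw [this, fderiv_comp _ (Complex.ofRealCLM.differentiableAt) (f.differentiableAt)]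
    simp [pd]
  have ht : (inner ℝ · (ee i) : E3 → ℝ).HasTemperateGrowth := ((innerSL ℝ).flip (ee i)).hasTemperateGrowth
  rw [hat_eq, h1, fourier_lineDerivOp_eq, smul_apply, smulLeftCLM_apply_apply ht, ← hat_eq]
  simp [ee, EuclideanSpace.inner_single_right]
  ring

lemma ff_apply (F : 𝓢(E3, ℂ)) (x : E3) : 𝓕 (𝓕 F) x = F (-x) := by
  have h : 𝓕⁻ (𝓕 F) = F := FourierTransform.fourierInv_fourier_eq F
  have h2 : (𝓕⁻ (𝓕 F)) (-x) = 𝓕 (𝓕 F) x := by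
    rw [fourierInv_apply_eq]; simp
  rw [← h2, h]

lemma hat_mul_conv (f g : 𝓢(E3, ℝ)) :
    hat (mulS f g) = convolution (ContinuousLinearMap.mul ℂ ℂ) (hat g) (hat f) := by
  have hinj : Function.Injective (fun F : 𝓢(E3, ℂ) => 𝓕 F) := by
    intro A B h
    have := congrArg (fun F : 𝓢(E3, ℂ) => 𝓕⁻ F) h
    simpa using this
  apply hinj
  ext x
  simp only [fourier_convolution, hat_eq, pairing_apply_apply, ff_apply, postcompCLM_apply, mulS_apply]
  simp [mul_comm]

lemma hat_mul (f g : 𝓢(E3, ℝ)) (ξ : E3) : hat (mulS f g) ξ = ∫ η, hat f (ξ - η) * hat g η := by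
  rw [hat_mul_conv, SchwartzMap.convolution_apply, convolution_def]
  simp [mul_comm]

/-- curl on Schwartz fields -/
def curlS (u : Fin 3 → 𝓢(E3, ℝ)) : Fin 3 → 𝓢(E3, ℝ) :=
  ![pdS 1 (u 2) - pdS 2 (u 1), pdS 2 (u 0) - pdS 0 (u 2), pdS 0 (u 1) - pdS 1 (u 0)]

/-- strain on Schwartz fields -/
def strS (u : Fin 3 → 𝓢(E3, ℝ)) (i j : Fin 3) : 𝓢(E3, ℝ) := (1 / 2 : ℝ) • (pdS i (u j) + pdS j (u i))

lemma curlS_coe (u : Fin 3 → 𝓢(E3, ℝ)) (k : Fin 3) : ⇑(curlS u k) = curl (fun i => ⇑(u i)) k := by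
  fin_cases k <;> ext x <;> simp [curlS, curl, pdS_coe]

lemma strS_coe (u : Fin 3 → 𝓢(E3, ℝ)) (i j : Fin 3) : ⇑(strS u i j) = strain (fun i => ⇑(u i)) i j := by
  ext x; simp [strS, strain, pdS_coe]; ring

/-- velocity on the Fourier side -/
def vh (u : Fin 3 → 𝓢(E3, ℝ)) (ξ : E3) (i : Fin 3) : ℂ := hat (u i) ξ

lemma hat_curl (u : Fin 3 → 𝓢(E3, ℝ)) (k : Fin 3) (ξ : E3) : hat (curlS u k) ξ = cr ξ (vh u ξ) k := by
  fin_cases k <;> simp [curlS, cr, vh, hat_pdS] <;> ring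

lemma hat_str (u : Fin 3 → 𝓢(E3, ℝ)) (k j : Fin 3) (ξ : E3) : hat (strS u k j) ξ = sy ξ (vh u ξ) k j := by
  simp [strS, sy, vh, hat_pdS]; ring

lemma vh_conj (u : Fin 3 → 𝓢(E3, ℝ)) (ξ : E3) (i : Fin 3) : vh u (-ξ) i = star (vh u ξ i) := hat_conj _ _

lemma vh_div (u : Fin 3 → 𝓢(E3, ℝ)) (h : ∀ x : E3, ∑ i, pd i (⇑(u i)) x = 0) (ξ : E3) :
    dotc ξ (vh u ξ) = 0 := by
  have h0 : pdS 0 (u 0) + pdS 1 (u 1) + pdS 2 (u 2) = 0 := by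
    ext x
    have := h x
    rw [Fin.sum_univ_three] at this
    simpa [pdS_coe] using this
  have h1 := congrArg (fun f => hat f ξ) h0
  simp only [map_add, map_zero, add_apply, zero_apply, hat_pdS] at h1
  have h2 : (2 * π * Complex.I) * dotc ξ (vh u ξ) = 0 := by
    rw [← h1]; simp only [dotc, vh]; ring
  rcases mul_eq_zero.1 h2 with h3 | h3
  · exfalso; have := Real.pi_ne_zero; simp_all
  · exact h3

lemma hat_planch (f : 𝓢(E3, ℝ)) : ∫ ξ, ‖hat f ξ‖ ^ 2 = ∫ x, f x ^ 2 := by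
  rw [hat_eq, integral_norm_sq_fourier]
  simp

lemma schwartz_sq_int (F : 𝓢(E3, ℂ)) : Integrable (fun ξ => ‖F ξ‖ ^ 2) := by
  have := (F.memLp 2 volume).integrable_norm_pow (by norm_num)
  simpa using this


/-- The nonlinearity as a Schwartz function. -/
def nlS (u : Fin 3 → 𝓢(E3, ℝ)) (k : Fin 3) : 𝓢(E3, ℝ) :=
  mulS (u 0) (pdS 0 (curlS u k)) + mulS (u 1) (pdS 1 (curlS u k)) + mulS (u 2) (pdS 2 (curlS u k))
    - (mulS (strS u k 0) (curlS u 0) + mulS (strS u k 1) (curlS u 1)) - mulS (curlS u 2) (strS u k 2)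

/-- The integrand as products. -/
def nlP (u : Fin 3 → 𝓢(E3, ℝ)) (k : Fin 3) (ζ η : E3) : ℂ :=
  hat (u 0) ζ * hat (pdS 0 (curlS u k)) η + hat (u 1) ζ * hat (pdS 1 (curlS u k)) η
    + hat (u 2) ζ * hat (pdS 2 (curlS u k)) η
    - (hat (strS u k 0) ζ * hat (curlS u 0) η + hat (strS u k 1) ζ * hat (curlS u 1) η)
    - hat (curlS u 2) ζ * hat (strS u k 2) η

lemma nlP_eq (u : Fin 3 → 𝓢(E3, ℝ)) (k : Fin 3) (ζ η : E3) :
    nlP u k ζ η = nlk ζ η (vh u ζ) (vh u η) k := by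
  simp only [nlP, hat_pdS, hat_curl, hat_str, nlk, dotc]
  simp only [vh]; ring

lemma prod_int (F G : 𝓢(E3, ℂ)) :
    Integrable (fun p : E3 × E3 => F (p.1 - p.2) * G p.2) (volume.prod volume) := by
  have := Integrable.convolution_integrand (ContinuousLinearMap.mul ℂ ℂ) (μ := volume) (ν := volume)
    (G.integrable (μ := volume)) (F.integrable (μ := volume))
  refine this.congr (Filter.Eventually.of_forall fun p => ?_)
  simp [mul_comm]

lemma bdd_schwartz (F : 𝓢(E3, ℂ)) : ∃ C, ∀ x, ‖F x‖ ≤ C :=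
  ⟨_, fun x => norm_le_seminorm ℝ F x⟩

lemma slice_int (F G : 𝓢(E3, ℂ)) (ξ : E3) : Integrable (fun η : E3 => F (ξ - η) * G η) := by
  obtain ⟨C, hC⟩ := bdd_schwartz F
  refine (G.integrable (μ := volume)).bdd_mul (c := C) ?_ (Filter.Eventually.of_forall fun η => hC _)
  exact (F.continuous.comp (continuous_const.sub continuous_id)).aestronglyMeasurable

lemma nlP_prod_int (u : Fin 3 → 𝓢(E3, ℝ)) (k : Fin 3) :
    Integrable (fun p : E3 × E3 => nlP u k (p.1 - p.2) p.2) (volume.prod volume) := by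
  unfold nlP
  exact (((((prod_int _ _).add (prod_int _ _)).add (prod_int _ _)).sub
    ((prod_int _ _).add (prod_int _ _))).sub (prod_int _ _))

lemma nlP_slice (u : Fin 3 → 𝓢(E3, ℝ)) (k : Fin 3) (ξ : E3) :
    Integrable (fun η : E3 => nlP u k (ξ - η) η) ∧ hat (nlS u k) ξ = ∫ η, nlP u k (ξ - η) η := by
  have i1 := slice_int (hat (u 0)) (hat (pdS 0 (curlS u k))) ξ
  have i2 := slice_int (hat (u 1)) (hat (pdS 1 (curlS u k))) ξ
  have i3 := slice_int (hat (u 2)) (hat (pdS 2 (curlS u k))) ξ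
  have i4 := slice_int (hat (strS u k 0)) (hat (curlS u 0)) ξ
  have i5 := slice_int (hat (strS u k 1)) (hat (curlS u 1)) ξ
  have i6 := slice_int (hat (curlS u 2)) (hat (strS u k 2)) ξ
  have i12 := i1.add i2
  have i123 := i12.add i3
  have i45 := i4.add i5
  have i7 := i123.sub i45
  constructor
  · exact i7.sub i6
  · simp only [nlS, map_add, map_sub, add_apply, sub_apply, hat_mul]
    have := integral_sub i7 i6
    simp only [nlP]
    rw [← integral_add i1 i2]
    erw [← integral_add i12 i3]
    rw [← integral_add i4 i5]
    erw [← integral_sub i123 i45]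
    exact this.symm

/-- multiplier -/
def mlt (u : Fin 3 → 𝓢(E3, ℝ)) (k : Fin 3) (ξ : E3) : ℂ := -((1 / (2 * π * ‖ξ‖) : ℝ) : ℂ) * star (hat (curlS u k) ξ)

lemma mlt_meas (u : Fin 3 → 𝓢(E3, ℝ)) (k : Fin 3) : Measurable (mlt u k) := by
  unfold mlt
  have h1 : Measurable (fun ξ : E3 => -((1 / (2 * π * ‖ξ‖) : ℝ) : ℂ)) := by fun_prop
  have h2 : Measurable (fun ξ : E3 => star (hat (curlS u k) ξ)) :=
    (continuous_star.comp (hat (curlS u k)).continuous).measurable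
  exact h1.mul h2

lemma n3_bdd (u : Fin 3 → 𝓢(E3, ℝ)) : ∃ C, ∀ ξ, n3 (vh u ξ) ≤ C := by
  obtain ⟨C0, h0⟩ := bdd_schwartz (hat (u 0))
  obtain ⟨C1, h1⟩ := bdd_schwartz (hat (u 1))
  obtain ⟨C2, h2⟩ := bdd_schwartz (hat (u 2))
  refine ⟨√(C0 ^ 2 + C1 ^ 2 + C2 ^ 2), fun ξ => Real.sqrt_le_sqrt ?_⟩
  have := h0 ξ; have := h1 ξ; have := h2 ξ
  simp only [vh]; gcongr

lemma mlt_bdd (u : Fin 3 → 𝓢(E3, ℝ)) (hdiv : ∀ ξ, dotc ξ (vh u ξ) = 0) (k : Fin 3) (ξ : E3) :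
    ‖mlt u k ξ‖ ≤ n3 (vh u ξ) := by
  have hp := Real.pi_pos
  rcases eq_or_ne ξ 0 with rfl | hξ
  · simp [mlt, n3_nonneg]
  have hpos : 0 < ‖ξ‖ := norm_pos_iff.2 hξ
  have h1 : ‖hat (curlS u k) ξ‖ ≤ 2 * π * ‖ξ‖ * n3 (vh u ξ) := by
    rw [hat_curl, ← cr_norm _ _ (hdiv ξ)]; exact norm_le_n3 _ _
  rw [mlt, norm_mul, norm_neg, norm_star, Complex.norm_real, Real.norm_of_nonneg (by positivity),
    one_div_mul_eq_div, div_le_iff₀ (by positivity)]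
  linarith

lemma II_eq (u : Fin 3 → 𝓢(E3, ℝ)) (ξ η : E3) :
    II (vh u) ξ η = (mlt u 0 ξ * nlP u 0 (ξ - η) η + mlt u 1 ξ * nlP u 1 (ξ - η) η).re := by
  rw [II, nlP_eq, nlP_eq, mlt, mlt, hat_curl, hat_curl, neg_mul, ← Complex.re_ofReal_mul, ← Complex.neg_re]
  congr 1; ring

lemma II_int (u : Fin 3 → 𝓢(E3, ℝ)) (hdiv : ∀ ξ, dotc ξ (vh u ξ) = 0) :
    Integrable (fun p : E3 × E3 => II (vh u) p.1 p.2) (volume.prod volume) := by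
  obtain ⟨C, hC⟩ := n3_bdd u
  have h : ∀ k, Integrable (fun p : E3 × E3 => mlt u k p.1 * nlP u k (p.1 - p.2) p.2) (volume.prod volume) := by
    intro k
    refine (nlP_prod_int u k).bdd_mul (c := C) ?_ (Filter.Eventually.of_forall fun p => (mlt_bdd u hdiv k _).trans (hC _))
    exact ((mlt_meas u k).comp measurable_fst).aestronglyMeasurable
  simp only [II_eq]
  exact ((h 0).add (h 1)).re

lemma II_slice (u : Fin 3 → 𝓢(E3, ℝ)) (ξ : E3) :
    ∫ η, II (vh u) ξ η = (mlt u 0 ξ * hat (nlS u 0) ξ + mlt u 1 ξ * hat (nlS u 1) ξ).re := by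
  have h0 := nlP_slice u 0 ξ
  have h1 := nlP_slice u 1 ξ
  simp only [II_eq]
  rw [h0.2, h1.2, ← integral_const_mul, ← integral_const_mul, ← integral_add (h0.1.const_mul _) (h1.1.const_mul _)]
  exact integral_re ((h0.1.const_mul _).add (h1.1.const_mul _))

lemma U_int (u : Fin 3 → 𝓢(E3, ℝ)) : Integrable (fun ξ => n3 (cr ξ (vh u ξ)) ^ 2) := by
  simp only [n3_sq, ← hat_curl]
  exact ((schwartz_sq_int _).add (schwartz_sq_int _)).add (schwartz_sq_int _)

lemma n3v_int (u : Fin 3 → 𝓢(E3, ℝ)) : Integrable (fun ξ => n3 (vh u ξ) ^ 2) := by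
  simp only [n3_sq, vh]
  exact ((schwartz_sq_int _).add (schwartz_sq_int _)).add (schwartz_sq_int _)

lemma g_int (u : Fin 3 → 𝓢(E3, ℝ)) : Integrable (fun ξ => gh (cr ξ (vh u ξ)) ^ 2) := by
  simp only [gh_sq, ← hat_curl]
  exact (schwartz_sq_int _).add (schwartz_sq_int _)

lemma x_int (u : Fin 3 → 𝓢(E3, ℝ)) (hdiv : ∀ ξ, dotc ξ (vh u ξ) = 0) :
    Integrable (fun ξ => gh (cr ξ (vh u ξ)) ^ 2 * (1 / (2 * π * ‖ξ‖))) := by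
  have hp := Real.pi_pos
  refine ((g_int u).add (n3v_int u)).mono' ?_ (Filter.Eventually.of_forall fun ξ => ?_)
  · exact (g_int u).aestronglyMeasurable.mul (Measurable.aestronglyMeasurable (by fun_prop))
  · rw [Real.norm_of_nonneg (by positivity)]
    show _ ≤ gh (cr ξ (vh u ξ)) ^ 2 + n3 (vh u ξ) ^ 2
    rcases eq_or_ne ξ 0 with rfl | hξ
    · simp; positivity
    have hpos : 0 < ‖ξ‖ := norm_pos_iff.2 hξ
    have h1 := (gh_le_n3 (cr ξ (vh u ξ))).trans_eq (cr_norm _ _ (hdiv ξ))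
    rw [mul_one_div, div_le_iff₀ (by positivity)]
    have h2 := gh_nonneg (cr ξ (vh u ξ))
    have h3 := n3_nonneg (vh u ξ)
    have h4 : gh (cr ξ (vh u ξ)) ^ 2 ≤ gh (cr ξ (vh u ξ)) * (2 * π * ‖ξ‖ * n3 (vh u ξ)) := by
      rw [sq]; gcongr
    have h5 : gh (cr ξ (vh u ξ)) * n3 (vh u ξ) ≤ gh (cr ξ (vh u ξ)) ^ 2 + n3 (vh u ξ) ^ 2 := by nlinarith [sq_nonneg (gh (cr ξ (vh u ξ)) - n3 (vh u ξ)), mul_nonneg h2 h3]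
    nlinarith [mul_le_mul_of_nonneg_left h5 (show 0 ≤ 2 * π * ‖ξ‖ by positivity)]

lemma xsq_int (F : 𝓢(E3, ℂ)) : Integrable (fun ξ => ‖F ξ‖ ^ 2 * (2 * π * ‖ξ‖)) := by
  obtain ⟨C, hC⟩ := bdd_schwartz F
  have h1 : Integrable (fun ξ => ‖ξ‖ ^ 1 * ‖F ξ‖) := F.integrable_pow_mul volume 1
  have h2 := (h1.const_mul (2 * π)).bdd_mul (c := C) (f := fun ξ => ‖F ξ‖)
    F.continuous.norm.aestronglyMeasurable (Filter.Eventually.of_forall fun ξ => by simpa using hC ξ)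
  refine h2.congr (Filter.Eventually.of_forall fun ξ => ?_)
  simp; ring

lemma y_int (u : Fin 3 → 𝓢(E3, ℝ)) : Integrable (fun ξ => gh (cr ξ (vh u ξ)) ^ 2 * (2 * π * ‖ξ‖)) := by
  simp only [gh_sq, ← hat_curl, add_mul]
  exact (xsq_int _).add (xsq_int _)

/-- Instantaneous energy inequality. -/
lemma energy_ineq (u : Fin 3 → 𝓢(E3, ℝ)) (hdiv : ∀ ξ, dotc ξ (vh u ξ) = 0) (ν : ℝ) (hν : 0 < ν)
    (W' : Fin 3 → E3 → ℂ)
    (hW : ∀ k ξ, W' k ξ = -(ν * (2 * π * ‖ξ‖) ^ 2 : ℝ) * hat (curlS u k) ξ - hat (nlS u k) ξ) :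
    ∫ ξ, (1 / (2 * π * ‖ξ‖)) * (2 * (star (hat (curlS u 0) ξ) * W' 0 ξ + star (hat (curlS u 1) ξ) * W' 1 ξ).re)
      ≤ 2 * (CC ^ 2 * (∫ ξ, n3 (cr ξ (vh u ξ)) ^ 2) ^ 2 / ν ^ 3) *
        ∫ ξ, gh (cr ξ (vh u ξ)) ^ 2 * (1 / (2 * π * ‖ξ‖)) := by
  have hp := Real.pi_pos
  have hN := N_bound (vh u) hdiv (vh_conj u) (II_int u hdiv) (U_int u) (x_int u hdiv) (y_int u) ν hν
  have hIi : Integrable (fun ξ => ∫ η, II (vh u) ξ η) := (II_int u hdiv).integral_prod_left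
  have e : ∀ ξ : E3, (1 / (2 * π * ‖ξ‖)) * (2 * (star (hat (curlS u 0) ξ) * W' 0 ξ + star (hat (curlS u 1) ξ) * W' 1 ξ).re)
      = 2 * (∫ η, II (vh u) ξ η) - 2 * ν * (gh (cr ξ (vh u ξ)) ^ 2 * (2 * π * ‖ξ‖)) := by
    intro ξ
    rw [II_slice, hW, hW, gh_sq, ← hat_curl, ← hat_curl, cnorm_sq, cnorm_sq]
    simp only [mlt]
    generalize hat (curlS u 0) ξ = a
    generalize hat (curlS u 1) ξ = b
    generalize hat (nlS u 0) ξ = a'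
    generalize hat (nlS u 1) ξ = b'
    rcases eq_or_ne ξ 0 with rfl | hξ
    · simp
    have hpos : 0 < ‖ξ‖ := norm_pos_iff.2 hξ
    have hr : 0 < 2 * π * ‖ξ‖ := by positivity
    generalize 2 * π * ‖ξ‖ = r at hr
    simp only [Complex.add_re, Complex.mul_re, Complex.mul_im, Complex.sub_re, Complex.sub_im, Complex.neg_re, Complex.neg_im, Complex.star_def,
      Complex.conj_re, Complex.conj_im, Complex.ofReal_re, Complex.ofReal_im]
    field_simp
    ring
  simp only [e]
  rw [integral_sub (hIi.const_mul _) ((y_int u).const_mul _), integral_const_mul, integral_const_mul]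
  linarith


/-- Uniform boundedness of Schwartz seminorms on the time interval `[0,t]`. -/
def UB {V : Type*} [NormedAddCommGroup V] [NormedSpace ℝ V] (t : ℝ) (F : ℝ → 𝓢(E3, V)) : Prop :=
  ∀ k n : ℕ, ∃ C, ∀ s ∈ Set.Icc 0 t, SchwartzMap.seminorm ℝ k n (F s) ≤ C

lemma UB_iff {V : Type*} [NormedAddCommGroup V] [NormedSpace ℝ V] (t : ℝ) (F : ℝ → 𝓢(E3, V)) :
    UB t F ↔ Bornology.IsVonNBounded ℝ (F '' Set.Icc 0 t) := by
  rw [WithSeminorms.image_isVonNBounded_iff_seminorm_bounded F (schwartz_withSeminorms ℝ E3 V)]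
  constructor
  · intro h i
    obtain ⟨C, hC⟩ := h i.1 i.2
    refine ⟨max C 0 + 1, by positivity, fun s hs => ?_⟩
    have := hC s hs
    have := le_max_left C 0
    simp only [schwartzSeminormFamily]
    linarith
  · intro h k n
    obtain ⟨C, -, hC⟩ := h (k, n)
    exact ⟨C, fun s hs => (hC s hs).le⟩

lemma UB.clm {V W : Type*} [NormedAddCommGroup V] [NormedSpace ℝ V] [NormedAddCommGroup W] [NormedSpace ℝ W]
    {t : ℝ} {F : ℝ → 𝓢(E3, V)} (h : UB t F) (L : 𝓢(E3, V) →L[ℝ] 𝓢(E3, W)) : UB t (fun s => L (F s)) := by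
  rw [UB_iff] at h ⊢
  have := h.image L
  rwa [Set.image_image] at this

lemma UB.sub {V : Type*} [NormedAddCommGroup V] [NormedSpace ℝ V]
    {t : ℝ} {F G : ℝ → 𝓢(E3, V)} (h : UB t F) (h' : UB t G) : UB t (fun s => F s - G s) := by
  intro k n
  obtain ⟨C, hC⟩ := h k n
  obtain ⟨D, hD⟩ := h' k n
  refine ⟨C + D, fun s hs => ?_⟩
  exact (map_sub_le_add _ _ _).trans (add_le_add (hC s hs) (hD s hs))

lemma UB.pdS {t : ℝ} {F : ℝ → 𝓢(E3, ℝ)} (h : UB t F) (i : Fin 3) : UB t (fun s => pdS i (F s)) :=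
  h.clm (LineDeriv.lineDerivOpCLM ℝ 𝓢(E3, ℝ) (ee i))

lemma UB.curlS {t : ℝ} {u : ℝ → Fin 3 → 𝓢(E3, ℝ)} (h : ∀ i, UB t (fun s => u s i)) (k : Fin 3) :
    UB t (fun s => curlS (u s) k) := by
  fin_cases k
  · exact ((h 2).pdS 1).sub ((h 1).pdS 2)
  · exact ((h 0).pdS 2).sub ((h 2).pdS 0)
  · exact ((h 1).pdS 0).sub ((h 0).pdS 1)

lemma UB.bdd {V : Type*} [NormedAddCommGroup V] [NormedSpace ℝ V] {t : ℝ} {F : ℝ → 𝓢(E3, V)} (h : UB t F) :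
    ∃ C, 0 ≤ C ∧ ∀ s ∈ Set.Icc 0 t, ∀ x, ‖F s x‖ ≤ C := by
  obtain ⟨C, hC⟩ := h 0 0
  refine ⟨max C 0, le_max_right _ _, fun s hs x => ?_⟩
  exact ((norm_le_seminorm ℝ (F s) x).trans (hC s hs)).trans (le_max_left _ _)

/-- An integrable weight. -/
def wt (x : E3) : ℝ := (1 + ‖x‖) ^ (-(4 : ℝ))

lemma wt_pos (x : E3) : 0 < wt x := by unfold wt; positivity

lemma wt_int : Integrable wt := by
  apply integrable_one_add_norm
  simp; norm_num

lemma UB.decay {V : Type*} [NormedAddCommGroup V] [NormedSpace ℝ V] {t : ℝ} {F : ℝ → 𝓢(E3, V)} (h : UB t F) :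
    ∃ C, 0 ≤ C ∧ ∀ s ∈ Set.Icc 0 t, ∀ x, ‖F s x‖ ≤ C * wt x := by
  obtain ⟨C, hC⟩ := h 0 0
  obtain ⟨D, hD⟩ := h 4 0
  refine ⟨max (8 * (C + D)) 0, le_max_right _ _, fun s hs x => ?_⟩
  refine le_trans ?_ (mul_le_mul_of_nonneg_right (le_max_left _ _) (wt_pos x).le)
  have h1 := (norm_le_seminorm ℝ (F s) x).trans (hC s hs)
  have h2 := (norm_pow_mul_le_seminorm ℝ (F s) 4 x).trans (hD s hs)
  have h3 : wt x = ((1 + ‖x‖) ^ 4)⁻¹ := by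
    unfold wt
    rw [Real.rpow_neg (by positivity)]
    norm_cast
  rw [h3, ← div_eq_mul_inv, le_div_iff₀ (by positivity)]
  have h4 : (1 + ‖x‖) ^ 4 ≤ 8 * (1 + ‖x‖ ^ 4) := by
    nlinarith [sq_nonneg (‖x‖ - 1), sq_nonneg (‖x‖ ^ 2 - 1), sq_nonneg (‖x‖ ^ 2 - ‖x‖), sq_nonneg (‖x‖), norm_nonneg x]
  have := mul_le_mul_of_nonneg_left h4 (norm_nonneg (F s x))
  nlinarith

lemma ft_eq (F : 𝓢(E3, ℂ)) (ξ : E3) : (𝓕 F) ξ = ∫ x, 𝐞 (-(inner ℝ x ξ)) • F x := by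
  rw [SchwartzMap.fourier_coe, Real.fourier_eq]

lemma FD {t : ℝ} (F F' : ℝ → 𝓢(E3, ℂ)) (hU : UB t F')
    (h : ∀ s ∈ Set.Ioo 0 t, ∀ x, HasDerivAt (fun s => F s x) (F' s x) s) (ξ : E3) :
    ∀ s ∈ Set.Ioo 0 t, HasDerivAt (fun s => (𝓕 (F s)) ξ) ((𝓕 (F' s)) ξ) s := by
  intro s hs
  obtain ⟨C, hC0, hC⟩ := hU.decay
  simp only [ft_eq]
  have hm : ∀ G : 𝓢(E3, ℂ), Integrable (fun x => 𝐞 (-(inner ℝ x ξ)) • G x) := by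
    intro G
    have := (Real.fourierIntegral_convergent_iff (μ := volume) (f := G) ξ).2 G.integrable
    exact this
  refine (hasDerivAt_integral_of_dominated_loc_of_deriv_le (Ioo_mem_nhds hs.1 hs.2)
    (Filter.Eventually.of_forall fun r => (hm (F r)).aestronglyMeasurable) (hm _)
    (F' := fun r x => 𝐞 (-(inner ℝ x ξ)) • F' r x)
    (hm (F' s)).aestronglyMeasurable (bound := fun x => C * wt x)
    (Filter.Eventually.of_forall fun x r hr => ?_) (wt_int.const_mul C)
    (Filter.Eventually.of_forall fun x r hr => ?_)).2
  · rw [Circle.norm_smul]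
    exact hC r ⟨hr.1.le, hr.2.le⟩ x
  · exact (h r hr x).const_smul (𝐞 (-(inner ℝ x ξ)))

lemma FC {t : ℝ} (F : ℝ → 𝓢(E3, ℂ)) (hU : UB t F)
    (h : ∀ x, ContinuousOn (fun s => F s x) (Set.Icc 0 t)) (ξ : E3) :
    ContinuousOn (fun s => (𝓕 (F s)) ξ) (Set.Icc 0 t) := by
  obtain ⟨C, hC0, hC⟩ := hU.decay
  simp only [ft_eq]
  have hm : ∀ G : 𝓢(E3, ℂ), Integrable (fun x => 𝐞 (-(inner ℝ x ξ)) • G x) := by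
    intro G
    have := (Real.fourierIntegral_convergent_iff (μ := volume) (f := G) ξ).2 G.integrable
    exact this
  refine MeasureTheory.continuousOn_of_dominated (fun r hr => (hm (F r)).aestronglyMeasurable)
    (bound := fun x => C * wt x)
    (fun r hr => Filter.Eventually.of_forall fun x => ?_) (wt_int.const_mul C)
    (Filter.Eventually.of_forall fun x => ?_)
  · rw [Circle.norm_smul]
    exact hC r hr x
  · exact (h x).const_smul (𝐞 (-(inner ℝ x ξ)))


section sol
variable {ν : ℝ} {T : ℝ≥0∞} (sol : AdmissibleSolution ν T) {t : ℝ}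

lemma Icc_sub (ht : t ∈ timeSet T) : Set.Icc 0 t ⊆ timeSet T := fun _ hs =>
  ⟨hs.1, (ENNReal.ofReal_le_ofReal hs.2).trans_lt ht.2⟩

lemma ts_nhds (ht : t ∈ timeSet T) {s : ℝ} (hs : s ∈ Set.Ioo 0 t) : timeSet T ∈ nhds s :=
  Filter.mem_of_superset (Icc_mem_nhds hs.1 hs.2) (Icc_sub ht)

lemma u_UB (ht : t ∈ timeSet T) (i : Fin 3) : UB t (fun s => sol.u s i) := by
  intro k n
  obtain ⟨C, hC⟩ := sol.seminorm_bdd _ isCompact_Icc (Icc_sub ht) k n i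
  exact ⟨C, fun s hs => (hC s hs).1⟩

lemma u'_UB (ht : t ∈ timeSet T) (i : Fin 3) : UB t (fun s => sol.u' s i) := by
  intro k n
  obtain ⟨C, hC⟩ := sol.seminorm_bdd _ isCompact_Icc (Icc_sub ht) k n i
  exact ⟨C, fun s hs => (hC s hs).2⟩

lemma hatu_deriv (ht : t ∈ timeSet T) (i : Fin 3) (ξ : E3) (s : ℝ) (hs : s ∈ Set.Ioo 0 t) :
    HasDerivAt (fun s => hat (sol.u s i) ξ) (hat (sol.u' s i) ξ) s := by
  simp only [hat_eq]
  refine FD (fun s => postcompCLM Complex.ofRealCLM (sol.u s i))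
    (fun s => postcompCLM Complex.ofRealCLM (sol.u' s i)) ((u'_UB sol ht i).clm (postcompCLM Complex.ofRealCLM)) ?_ ξ s hs
  intro r hr x
  have := (sol.tderiv r (Icc_sub ht ⟨hr.1.le, hr.2.le⟩) i x).hasDerivAt (ts_nhds ht hr)
  exact this.ofReal_comp

lemma hatu_cont (ht : t ∈ timeSet T) (i : Fin 3) (ξ : E3) :
    ContinuousOn (fun s => hat (sol.u s i) ξ) (Set.Icc 0 t) := by
  simp only [hat_eq]
  refine FC (fun s => postcompCLM Complex.ofRealCLM (sol.u s i)) ((u_UB sol ht i).clm (postcompCLM Complex.ofRealCLM)) ?_ ξ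
  intro x
  have : ContinuousOn (fun s => sol.u s i x) (Set.Icc 0 t) := fun r hr =>
    ((sol.tderiv r (Icc_sub ht hr) i x).continuousWithinAt).mono (Icc_sub ht)
  exact Complex.continuous_ofReal.comp_continuousOn this

lemma hatw_deriv (ht : t ∈ timeSet T) (k : Fin 3) (ξ : E3) (s : ℝ) (hs : s ∈ Set.Ioo 0 t) :
    HasDerivAt (fun s => hat (curlS (sol.u s) k) ξ) (hat (curlS (sol.u' s) k) ξ) s := by
  have h := fun i => hatu_deriv sol ht i ξ s hs
  simp only [hat_curl]
  fin_cases k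
  · have := ((((h 2).const_mul (ξ 1 : ℂ)).sub ((h 1).const_mul (ξ 2 : ℂ)))).const_mul (2 * π * Complex.I)
    refine (this.congr_deriv ?_).congr_of_eventuallyEq (Filter.Eventually.of_forall fun r => ?_)
    · simp [cr, vh]; try ring
    · simp [cr, vh]; try ring
  · have := ((((h 0).const_mul (ξ 2 : ℂ)).sub ((h 2).const_mul (ξ 0 : ℂ)))).const_mul (2 * π * Complex.I)
    refine (this.congr_deriv ?_).congr_of_eventuallyEq (Filter.Eventually.of_forall fun r => ?_)
    · simp [cr, vh]; try ring
    · simp [cr, vh]; try ring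
  · have := ((((h 1).const_mul (ξ 0 : ℂ)).sub ((h 0).const_mul (ξ 1 : ℂ)))).const_mul (2 * π * Complex.I)
    refine (this.congr_deriv ?_).congr_of_eventuallyEq (Filter.Eventually.of_forall fun r => ?_)
    · simp [cr, vh]; try ring
    · simp [cr, vh]; try ring

lemma hatw_cont (ht : t ∈ timeSet T) (k : Fin 3) (ξ : E3) :
    ContinuousOn (fun s => hat (curlS (sol.u s) k) ξ) (Set.Icc 0 t) := by
  have h := fun i => hatu_cont sol ht i ξ
  simp only [hat_curl]
  fin_cases k
  · have := ((h 2).const_mul (ξ 1 : ℂ)).sub ((h 1).const_mul (ξ 2 : ℂ)) |>.const_mul (2 * π * Complex.I)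
    convert this using 1
    ext r; simp [cr, vh]; try ring
  · have := ((h 0).const_mul (ξ 2 : ℂ)).sub ((h 2).const_mul (ξ 0 : ℂ)) |>.const_mul (2 * π * Complex.I)
    convert this using 1
    ext r; simp [cr, vh]; try ring
  · have := ((h 1).const_mul (ξ 0 : ℂ)).sub ((h 0).const_mul (ξ 1 : ℂ)) |>.const_mul (2 * π * Complex.I)
    convert this using 1
    ext r; simp [cr, vh]; try ring

lemma hatw'_UB (ht : t ∈ timeSet T) (k : Fin 3) : UB t (fun s => hat (curlS (sol.u' s) k)) :=
  (UB.curlS (u'_UB sol ht) k).clm hat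

lemma hatw_UB (ht : t ∈ timeSet T) (k : Fin 3) : UB t (fun s => hat (curlS (sol.u s) k)) :=
  (UB.curlS (u_UB sol ht) k).clm hat

lemma hathat (f : 𝓢(E3, ℝ)) (x : E3) : (𝓕 (hat f)) (-x) = (f x : ℂ) := by
  rw [hat_eq, ff_apply]; simp

lemma w_deriv (ht : t ∈ timeSet T) (k : Fin 3) (x : E3) (s : ℝ) (hs : s ∈ Set.Ioo 0 t) :
    HasDerivAt (fun s => curlS (sol.u s) k x) (curlS (sol.u' s) k x) s := by
  have := FD (fun s => hat (curlS (sol.u s) k)) (fun s => hat (curlS (sol.u' s) k)) (hatw'_UB sol ht k)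
    (fun r hr ξ => hatw_deriv sol ht k ξ r hr) (-x) s hs
  simp only [hathat] at this
  have h2 := (Complex.reCLM.hasFDerivAt.comp_hasDerivAt s this)
  exact h2

lemma w_eq (ht : t ∈ timeSet T) (k : Fin 3) (s : ℝ) (hs : s ∈ Set.Ioo 0 t) :
    curlS (sol.u' s) k = ν • (pdS 0 (pdS 0 (curlS (sol.u s) k)) + pdS 1 (pdS 1 (curlS (sol.u s) k))
      + pdS 2 (pdS 2 (curlS (sol.u s) k))) - nlS (sol.u s) k := by
  ext x
  have h := sol.vort_eq s (Icc_sub ht ⟨hs.1.le, hs.2.le⟩) x k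
  rw [derivWithin_of_mem_nhds (ts_nhds ht hs)] at h
  simp only [← curlS_coe, ← strS_coe, ← pdS_coe] at h
  rw [(w_deriv sol ht k x s hs).deriv] at h
  simp only [Fin.sum_univ_three] at h
  simp only [nlS, sub_apply, add_apply, smul_apply, mulS_apply, smul_eq_mul]
  linarith

lemma W_eq (ht : t ∈ timeSet T) (k : Fin 3) (s : ℝ) (hs : s ∈ Set.Ioo 0 t) (ξ : E3) :
    hat (curlS (sol.u' s) k) ξ = -(ν * (2 * π * ‖ξ‖) ^ 2 : ℝ) * hat (curlS (sol.u s) k) ξ - hat (nlS (sol.u s) k) ξ := by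
  rw [w_eq sol ht k s hs]
  simp only [map_sub, map_add, map_smul, sub_apply, add_apply, smul_apply, hat_pdS]
  rw [mul_pow, E3_norm_sq]
  simp only [Complex.real_smul]
  push_cast
  linear_combination (-(ν : ℂ)) * (-4 * π ^ 2 * ((ξ 0 : ℂ) ^ 2 + (ξ 1 : ℂ) ^ 2 + (ξ 2 : ℂ) ^ 2) * hat (curlS (sol.u s) k) ξ) * Complex.I_sq

lemma sol_div {s : ℝ} (hs : s ∈ timeSet T) (ξ : E3) : dotc ξ (vh (sol.u s) ξ) = 0 :=
  vh_div _ (sol.divfree s hs) ξ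

lemma n3v_UB (ht : t ∈ timeSet T) : ∃ C, 0 ≤ C ∧ ∀ s ∈ Set.Icc 0 t, ∀ ξ, n3 (vh (sol.u s) ξ) ≤ C := by
  obtain ⟨a, ha0, ha⟩ := ((u_UB sol ht 0).clm hat).bdd
  obtain ⟨b, hb0, hb⟩ := ((u_UB sol ht 1).clm hat).bdd
  obtain ⟨c, hc0, hc⟩ := ((u_UB sol ht 2).clm hat).bdd
  refine ⟨a + b + c, by positivity, fun s hs ξ => ?_⟩
  apply abs_le_of_sq_le_sq' _ (by positivity) |>.2
  rw [n3_sq]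
  have h1 := ha s hs ξ
  have h2 := hb s hs ξ
  have h3 := hc s hs ξ
  simp only [vh]
  have := pow_le_pow_left₀ (norm_nonneg _) h1 2
  have := pow_le_pow_left₀ (norm_nonneg _) h2 2
  have := pow_le_pow_left₀ (norm_nonneg _) h3 2
  nlinarith [mul_nonneg ha0 hb0, mul_nonneg ha0 hc0, mul_nonneg hb0 hc0]

/-- The squared negative Sobolev norm. -/
def XX (s : ℝ) : ℝ := ∫ ξ, gh (cr ξ (vh (sol.u s) ξ)) ^ 2 * (1 / (2 * π * ‖ξ‖))

/-- The squared L2 norm of the vorticity. -/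
def EE (s : ℝ) : ℝ := ∫ ξ, n3 (cr ξ (vh (sol.u s) ξ)) ^ 2

lemma W_le {s : ℝ} (hs : s ∈ timeSet T) (k : Fin 3) (ξ : E3) :
    ‖hat (curlS (sol.u s) k) ξ‖ * (1 / (2 * π * ‖ξ‖)) ≤ n3 (vh (sol.u s) ξ) := by
  have h : ‖hat (curlS (sol.u s) k) ξ‖ ≤ 2 * π * ‖ξ‖ * n3 (vh (sol.u s) ξ) := by
    rw [hat_curl, ← cr_norm _ _ (sol_div sol hs ξ)]
    exact norm_le_n3 _ _
  rcases eq_or_ne ξ 0 with h0 | h0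
  · simp [h0, n3_nonneg]
  · have : 0 < 2 * π * ‖ξ‖ := by have := norm_pos_iff.2 h0; positivity
    rw [mul_one_div, div_le_iff₀ this]
    linarith

lemma gh_cr (u : Fin 3 → 𝓢(E3, ℝ)) (ξ : E3) :
    gh (cr ξ (vh u ξ)) ^ 2 = ‖hat (curlS u 0) ξ‖ ^ 2 + ‖hat (curlS u 1) ξ‖ ^ 2 := by
  rw [gh_sq, hat_curl, hat_curl]

lemma n3_cr (u : Fin 3 → 𝓢(E3, ℝ)) (ξ : E3) :
    n3 (cr ξ (vh u ξ)) ^ 2 = ‖hat (curlS u 0) ξ‖ ^ 2 + ‖hat (curlS u 1) ξ‖ ^ 2 + ‖hat (curlS u 2) ξ‖ ^ 2 := by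
  rw [n3_sq, hat_curl, hat_curl, hat_curl]

lemma XX_cont (ht : t ∈ timeSet T) : ContinuousOn (XX sol) (Set.Icc 0 t) := by
  obtain ⟨A, hA0, hA⟩ := n3v_UB sol ht
  obtain ⟨B, hB0, hB⟩ := (hatw_UB sol ht 0).decay
  obtain ⟨C, hC0, hC⟩ := (hatw_UB sol ht 1).decay
  unfold XX
  refine MeasureTheory.continuousOn_of_dominated (fun r hr => (x_int _ (sol_div sol (Icc_sub ht hr))).aestronglyMeasurable)
    (bound := fun ξ => A * (B + C) * wt ξ)
    (fun r hr => Filter.Eventually.of_forall fun ξ => ?_) (wt_int.const_mul _)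
    (Filter.Eventually.of_forall fun ξ => ?_)
  · rw [Real.norm_of_nonneg (by positivity), gh_cr]
    have h0 := (W_le sol (Icc_sub ht hr) 0 ξ).trans (hA r hr ξ)
    have h1 := (W_le sol (Icc_sub ht hr) 1 ξ).trans (hA r hr ξ)
    have e0 := mul_le_mul h0 (hB r hr ξ) (norm_nonneg _) hA0
    have e1 := mul_le_mul h1 (hC r hr ξ) (norm_nonneg _) hA0
    calc _ = ‖hat (curlS (sol.u r) 0) ξ‖ * (1 / (2 * π * ‖ξ‖)) * ‖hat (curlS (sol.u r) 0) ξ‖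
        + ‖hat (curlS (sol.u r) 1) ξ‖ * (1 / (2 * π * ‖ξ‖)) * ‖hat (curlS (sol.u r) 1) ξ‖ := by ring
      _ ≤ _ := add_le_add e0 e1
      _ = _ := by ring
  · simp only [gh_cr]
    exact (((hatw_cont sol ht 0 ξ).norm.pow 2).add ((hatw_cont sol ht 1 ξ).norm.pow 2)).mul continuousOn_const

lemma EE_cont (ht : t ∈ timeSet T) : ContinuousOn (EE sol) (Set.Icc 0 t) := by
  have hb := fun k => (hatw_UB sol ht k).bdd
  have hd := fun k => (hatw_UB sol ht k).decay
  choose B hB0 hB using hb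
  choose D hD0 hD using hd
  unfold EE
  refine MeasureTheory.continuousOn_of_dominated (fun r hr => (U_int _).aestronglyMeasurable)
    (bound := fun ξ => (B 0 * D 0 + B 1 * D 1 + B 2 * D 2) * wt ξ)
    (fun r hr => Filter.Eventually.of_forall fun ξ => ?_) (wt_int.const_mul _)
    (Filter.Eventually.of_forall fun ξ => ?_)
  · rw [Real.norm_of_nonneg (by positivity), n3_cr]
    have e := fun k => mul_le_mul (hB k r hr ξ) (hD k r hr ξ) (norm_nonneg _) (hB0 k)
    have e0 := e 0
    have e1 := e 1
    have e2 := e 2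
    linarith
  · simp only [n3_cr]
    exact (((hatw_cont sol ht 0 ξ).norm.pow 2).add ((hatw_cont sol ht 1 ξ).norm.pow 2)).add ((hatw_cont sol ht 2 ξ).norm.pow 2)

lemma XX_deriv (ht : t ∈ timeSet T) (s : ℝ) (hs : s ∈ Set.Ioo 0 t) :
    HasDerivAt (XX sol) (∫ ξ, (1 / (2 * π * ‖ξ‖)) * (2 * (star (hat (curlS (sol.u s) 0) ξ) * hat (curlS (sol.u' s) 0) ξ
      + star (hat (curlS (sol.u s) 1) ξ) * hat (curlS (sol.u' s) 1) ξ).re)) s := by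
  obtain ⟨A, hA0, hA⟩ := n3v_UB sol ht
  obtain ⟨B, hB0, hB⟩ := (hatw'_UB sol ht 0).decay
  obtain ⟨C, hC0, hC⟩ := (hatw'_UB sol ht 1).decay
  unfold XX
  refine (hasDerivAt_integral_of_dominated_loc_of_deriv_le (Ioo_mem_nhds hs.1 hs.2)
    (Filter.eventually_of_mem (ts_nhds ht hs) fun r hr => (x_int _ (sol_div sol hr)).aestronglyMeasurable)
    (x_int _ (sol_div sol (Icc_sub ht ⟨hs.1.le, hs.2.le⟩)))
    (F' := fun s ξ => (1 / (2 * π * ‖ξ‖)) * (2 * (star (hat (curlS (sol.u s) 0) ξ) * hat (curlS (sol.u' s) 0) ξ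
      + star (hat (curlS (sol.u s) 1) ξ) * hat (curlS (sol.u' s) 1) ξ).re))
    ?_ (bound := fun ξ => 2 * (A * (B + C)) * wt ξ)
    (Filter.Eventually.of_forall fun ξ r hr => ?_) (wt_int.const_mul _)
    (Filter.Eventually.of_forall fun ξ r hr => ?_)).2
  · apply Measurable.aestronglyMeasurable
    have h := fun F : 𝓢(E3, ℂ) => F.continuous.measurable
    have h1 := h (hat (curlS (sol.u s) 0))
    have h2 := h (hat (curlS (sol.u s) 1))
    have h3 := h (hat (curlS (sol.u' s) 0))
    have h4 := h (hat (curlS (sol.u' s) 1))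
    have h5 : Measurable (fun ξ => star (hat (curlS (sol.u s) 0) ξ)) := continuous_star.measurable.comp h1
    have h6 : Measurable (fun ξ => star (hat (curlS (sol.u s) 1) ξ)) := continuous_star.measurable.comp h2
    have h7 : Measurable (fun ξ => (star (hat (curlS (sol.u s) 0) ξ) * hat (curlS (sol.u' s) 0) ξ
      + star (hat (curlS (sol.u s) 1) ξ) * hat (curlS (sol.u' s) 1) ξ).re) :=
      Complex.measurable_re.comp ((h5.mul h3).add (h6.mul h4))
    exact (by fun_prop : Measurable (fun ξ : E3 => 1 / (2 * π * ‖ξ‖))).mul (h7.const_mul 2)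
  · have hr' : r ∈ Set.Icc 0 t := ⟨hr.1.le, hr.2.le⟩
    have h0 := (W_le sol (Icc_sub ht hr') 0 ξ).trans (hA r hr' ξ)
    have h1 := (W_le sol (Icc_sub ht hr') 1 ξ).trans (hA r hr' ξ)
    have e0 := mul_le_mul h0 (hB r hr' ξ) (norm_nonneg _) hA0
    have e1 := mul_le_mul h1 (hC r hr' ξ) (norm_nonneg _) hA0
    have hn : ‖(star (hat (curlS (sol.u r) 0) ξ) * hat (curlS (sol.u' r) 0) ξ
      + star (hat (curlS (sol.u r) 1) ξ) * hat (curlS (sol.u' r) 1) ξ).re‖ ≤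
      ‖hat (curlS (sol.u r) 0) ξ‖ * ‖hat (curlS (sol.u' r) 0) ξ‖ + ‖hat (curlS (sol.u r) 1) ξ‖ * ‖hat (curlS (sol.u' r) 1) ξ‖ := by
      refine (Complex.abs_re_le_norm _).trans ((norm_add_le _ _).trans ?_)
      rw [norm_mul, norm_mul, norm_star, norm_star]
    have hp : 0 ≤ 1 / (2 * π * ‖ξ‖) := by positivity
    rw [norm_mul, norm_mul, Real.norm_of_nonneg hp, Real.norm_of_nonneg (by norm_num : (0:ℝ) ≤ 2)]
    have := mul_le_mul_of_nonneg_left hn hp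
    linarith
  · have h0 := (hatw_deriv sol ht 0 ξ r hr).norm_sq
    have h1 := (hatw_deriv sol ht 1 ξ r hr).norm_sq
    have := (h0.add h1).mul_const (1 / (2 * π * ‖ξ‖))
    refine (this.congr_deriv ?_).congr_of_eventuallyEq (Filter.Eventually.of_forall fun q => ?_)
    · simp only [Complex.inner, Complex.add_re, Complex.star_def]; ring
    · simp only [gh_cr, Pi.add_apply]

lemma XX_nonneg (s : ℝ) : 0 ≤ XX sol s := integral_nonneg fun ξ => by positivity

lemma XX_hs (s : ℝ) : hsV (-(1 / 2)) (sol.vorth s) = XX sol s := by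
  unfold hsV XX
  congr 1
  ext ξ
  have h : ∀ k, ft (sol.vort s k) = hat (curlS (sol.u s) k) := by
    intro k
    rw [← hat_ft, curlS_coe]; rfl
  have e0 : sol.vorth s 0 = sol.vort s 0 := rfl
  have e1 : sol.vorth s 1 = sol.vort s 1 := rfl
  have e2 : sol.vorth s 2 = ⇑(0 : 𝓢(E3, ℝ)) := rfl
  rw [Fin.sum_univ_three, e0, e1, e2, h, h, hat_ft, gh_cr]
  rw [show (2 * -(1 / 2) : ℝ) = -1 by norm_num, Real.rpow_neg_one]
  simp
  ring

lemma EE_eq (s : ℝ) : ∫ x : E3, ∑ k, (sol.vort s k x) ^ 2 = EE sol s := by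
  unfold EE
  have h : ∀ k x, sol.vort s k x = curlS (sol.u s) k x := by
    intro k x; rw [curlS_coe]; rfl
  simp only [h, n3_cr]
  have hi : ∀ f : 𝓢(E3, ℝ), Integrable (fun x => f x ^ 2) := by
    intro f
    have := schwartz_sq_int (postcompCLM Complex.ofRealCLM f)
    simpa using this
  rw [integral_finsetSum _ (fun k _ => hi _), Fin.sum_univ_three, integral_add, integral_add,
    hat_planch, hat_planch, hat_planch]
  · exact schwartz_sq_int _
  · exact schwartz_sq_int _
  · exact (schwartz_sq_int _).add (schwartz_sq_int _)
  · exact schwartz_sq_int _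

lemma const_le : 2 * CC ^ 2 ≤ 1 / R₂ := by
  unfold CC R₂
  have h3 := Real.pi_gt_three
  have h4 := Real.pi_lt_d2
  have h5 : (1.4 : ℝ) ≤ √2 := Real.le_sqrt_of_sq_le (by norm_num)
  rw [one_div_div, div_pow, ← mul_div_assoc, div_le_div_iff₀ (by positivity) (by positivity)]
  have h6 : (2.4 : ℝ) ^ 4 ≤ (1 + √2) ^ 4 := pow_le_pow_left₀ (by norm_num) (by linarith) 4
  have h7 : (5 * π + 1) ^ 2 ≤ 17 ^ 2 := pow_le_pow_left₀ (by positivity) (by linarith) 2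
  have h8 : (5 * π + 1) ^ 2 ≤ 12 * (1 + √2) ^ 4 := by norm_num at h6; linarith
  have : 0 < π ^ 4 := by positivity
  nlinarith

lemma R2_pos : 0 < R₂ := by unfold R₂; positivity

lemma gron (hν : 0 < ν) (ht : t ∈ timeSet T) (ht0 : 0 < t) :
    XX sol t ≤ XX sol 0 * Real.exp ((1 / (R₂ * ν ^ 3)) * ∫ τ in (0 : ℝ)..t, EE sol τ ^ 2) := by
  set a := 1 / (R₂ * ν ^ 3) with ha
  have hcE : ContinuousOn (fun s => EE sol s ^ 2) (Set.Icc 0 t) := (EE_cont sol ht).pow 2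
  set P : ℝ → ℝ := fun s => ∫ τ in (0 : ℝ)..s, EE sol τ ^ 2 with hP
  have hii : IntervalIntegrable (fun s => EE sol s ^ 2) volume 0 t := hcE.intervalIntegrable_of_Icc ht0.le
  have hPc : ContinuousOn P (Set.Icc 0 t) := by
    have := intervalIntegral.continuousOn_primitive_interval (hcE.integrableOn_Icc.mono_set (by rw [Set.uIcc_of_le ht0.le]) : IntegrableOn _ (Set.uIcc 0 t) volume)
    rwa [Set.uIcc_of_le ht0.le] at this
  have hPd : ∀ s ∈ Set.Ioo 0 t, HasDerivAt P (EE sol s ^ 2) s := by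
    intro s hs
    have hsub : Set.Icc 0 s ⊆ Set.Icc 0 t := Set.Icc_subset_Icc_right hs.2.le
    refine intervalIntegral.integral_hasDerivAt_right ((hcE.mono hsub).intervalIntegrable_of_Icc hs.1.le) ?_ ?_
    · exact ContinuousOn.stronglyMeasurableAtFilter isOpen_Ioo (hcE.mono Set.Ioo_subset_Icc_self) s hs
    · exact hcE.continuousAt (Icc_mem_nhds hs.1 hs.2)
  have hanti : AntitoneOn (fun s => XX sol s * Real.exp (-(a * P s))) (Set.Icc 0 t) := by
    have hd : ∀ s ∈ Set.Ioo 0 t, HasDerivAt (fun s => XX sol s * Real.exp (-(a * P s))) _ s := fun s hs =>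
      (XX_deriv sol ht s hs).mul (((hPd s hs).const_mul a).neg.exp)
    apply antitoneOn_of_deriv_nonpos (convex_Icc _ _)
    · exact (XX_cont sol ht).mul (Real.continuous_exp.comp_continuousOn ((hPc.const_mul a).neg))
    · rw [interior_Icc]
      exact fun s hs => (hd s hs).differentiableAt.differentiableWithinAt
    · rw [interior_Icc]
      intro s hs
      rw [(hd s hs).deriv]
      simp only [Pi.neg_apply]
      have h := energy_ineq (sol.u s) (sol_div sol (Icc_sub ht ⟨hs.1.le, hs.2.le⟩)) ν hν
        (fun k ξ => hat (curlS (sol.u' s) k) ξ) (fun k ξ => W_eq sol ht k s hs ξ)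
      change _ ≤ 2 * (CC ^ 2 * EE sol s ^ 2 / ν ^ 3) * XX sol s at h
      have h2 : 2 * (CC ^ 2 * EE sol s ^ 2 / ν ^ 3) ≤ a * EE sol s ^ 2 := by
        have : 2 * (CC ^ 2 * EE sol s ^ 2 / ν ^ 3) = 2 * CC ^ 2 * (EE sol s ^ 2 / ν ^ 3) := by ring
        rw [this]
        have h3 : a * EE sol s ^ 2 = 1 / R₂ * (EE sol s ^ 2 / ν ^ 3) := by
          have := R2_pos.ne'
          rw [ha]; field_simp
        rw [h3]
        exact mul_le_mul_of_nonneg_right const_le (by positivity)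
      have h3 := h.trans (mul_le_mul_of_nonneg_right h2 (XX_nonneg sol s))
      have he := Real.exp_pos (-(a * P s))
      have h4 := mul_le_mul_of_nonneg_right h3 he.le
      linarith
  have hf := hanti (Set.left_mem_Icc.2 ht0.le) (Set.right_mem_Icc.2 ht0.le) ht0.le
  have hP0 : P 0 = 0 := by simp [hP]
  simp only [hP0, mul_zero, neg_zero, Real.exp_zero, mul_one] at hf
  have := mul_le_mul_of_nonneg_right hf (Real.exp_pos (a * P t)).le
  rwa [mul_assoc, ← Real.exp_add, neg_add_cancel, Real.exp_zero, mul_one] at this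

end sol

/-- For an admissible solution of the vorticity equation on `[0,T)` with viscosity
`ν > 0`: for every `t ∈ [0,T)`,
`‖ω_h(t,·)‖²_{Ḣ^{−1/2}} ≤ ‖ω_h(0,·)‖²_{Ḣ^{−1/2}} exp((1/(R₂ν³))∫₀ᵗ‖ω(τ,·)‖⁴_{L²} dτ)`. -/
theorem statement10 (ν : ℝ) (hν : 0 < ν) (T : ℝ≥0∞) (hT : 0 < T)
    (sol : AdmissibleSolution ν T) :
    ∀ t ∈ timeSet T,
      hsV (-(1 / 2)) (sol.vorth t) ≤ hsV (-(1 / 2)) (sol.vorth 0) *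
        Real.exp ((1 / (R₂ * ν ^ 3)) *
          ∫ τ in (0 : ℝ)..t, (∫ x : E3, ∑ k, (sol.vort τ k x) ^ 2) ^ 2) := by
  intro t ht
  rw [XX_hs, XX_hs]
  simp only [EE_eq]
  rcases eq_or_lt_of_le ht.1 with h0 | h0
  · rw [← h0]; simp
  · exact gron sol hν ht h0
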